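/- arXiv:1505.01924 — 2 statements merged into one kernel-verified Lean document; each statement's English description precedes it below -/
import Mathlib

section
/- Let L̃ be a real-valued random variable with E[L̃] = 0, variance Var(L̃) = σ_L² > 0, and finite third absolute moment E[|L̃|³] < ∞. Let G̃ be a Gaussian random variable with distribution N(0, σ_G²), σ_G² > 0, independent of L̃. Define the normalized random variable Y = (L̃ + G̃) / √(σ_L² + σ_G²), and let F_Y denote its cumulative distribution function and Φ the cumulative distribution function of the standard normal distribution. Then sup_{y ∈ ℝ} |F_Y(y) − Φ(y)| ≤ τ, where τ = C₀ · E[|L̃|³] / (√(σ_L² + σ_G²))³ and C₀ = 0.56. -/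
open MeasureTheory ProbabilityTheory Real

/-- The standard normal distribution function. -/
noncomputable def Phi (x : ℝ) : ℝ := cdf (gaussianReal 0 1) x

/-- The standard normal density. -/
noncomputable def phi (x : ℝ) : ℝ := (√(2 * π))⁻¹ * exp (-x ^ 2 / 2)

lemma gaussianPDFReal_zero_one (x : ℝ) : gaussianPDFReal 0 1 x = phi x := by
  simp [gaussianPDFReal, phi]

lemma continuous_phi : Continuous phi := by unfold phi; fun_prop

lemma Phi_eq_integral (x : ℝ) : Phi x = ∫ u in Set.Iic x, phi u := by
  rw [Phi, cdf_eq_real, Measure.real, gaussianReal_apply_eq_integral _ one_ne_zero,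
    ENNReal.toReal_ofReal]
  · simp_rw [gaussianPDFReal_zero_one]
  · exact setIntegral_nonneg measurableSet_Iic fun u _ => gaussianPDFReal_nonneg _ _ _

lemma integrable_phi : Integrable phi := by
  have h := integrable_gaussianPDFReal 0 1
  rwa [show gaussianPDFReal 0 1 = phi from funext gaussianPDFReal_zero_one] at h

lemma hasDerivAt_Phi (x : ℝ) : HasDerivAt Phi (phi x) x := by
  have h : Phi = fun z => Phi 0 + ∫ u in (0 : ℝ)..z, phi u := by
    ext z
    rw [← intervalIntegral.integral_Iic_sub_Iic integrable_phi.integrableOn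
      integrable_phi.integrableOn, ← Phi_eq_integral, ← Phi_eq_integral]
    ring
  rw [h]
  exact (intervalIntegral.integral_hasDerivAt_right (continuous_phi.intervalIntegrable _ _)
    continuous_phi.aestronglyMeasurable.stronglyMeasurableAtFilter
    continuous_phi.continuousAt).const_add _

lemma continuous_Phi : Continuous Phi :=
  continuous_iff_continuousAt.2 fun x => (hasDerivAt_Phi x).continuousAt

lemma Phi_nonneg (x : ℝ) : 0 ≤ Phi x := cdf_nonneg _ _

lemma Phi_le_one (x : ℝ) : Phi x ≤ 1 := cdf_le_one _ _

lemma monotone_Phi : Monotone Phi := monotone_cdf _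

lemma Phi_neg (x : ℝ) : Phi (-x) = 1 - Phi x := by
  have h1 : Phi x + ∫ u in Set.Ioi x, phi u = 1 := by
    rw [Phi_eq_integral, ← integral_gaussianPDFReal_eq_one 0 (one_ne_zero (α := NNReal))]
    simp_rw [gaussianPDFReal_zero_one]
    rw [← Set.compl_Iic]
    exact integral_add_compl measurableSet_Iic integrable_phi
  have h2 : Phi (-x) = ∫ u in Set.Ioi x, phi u := by
    rw [Phi_eq_integral, ← integral_comp_neg_Ioi]
    simp [phi]
  linarith

lemma Phi_zero : Phi 0 = 1 / 2 := by
  have h := Phi_neg 0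
  rw [neg_zero] at h
  linarith

lemma phi_pos (x : ℝ) : 0 < phi x := by unfold phi; positivity

lemma phi_neg (x : ℝ) : phi (-x) = phi x := by simp [phi]

lemma inv_sqrt_two_pi_bounds : 0.3989 < (√(2 * π))⁻¹ ∧ (√(2 * π))⁻¹ < 0.399 := by
  have h1 := pi_gt_d4
  have h2 := pi_lt_d4
  constructor
  · rw [lt_inv_comm₀ (by norm_num) (by positivity), sqrt_lt' (by norm_num)]
    norm_num; linarith
  · rw [inv_lt_comm₀ (by positivity) (by norm_num), lt_sqrt (by norm_num)]
    norm_num; linarith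

lemma phi_zero_bounds : 0.3989 < phi 0 ∧ phi 0 < 0.399 := by
  simpa [phi] using inv_sqrt_two_pi_bounds

lemma phi_eq_phi_zero_mul (x : ℝ) : phi x = phi 0 * exp (-x ^ 2 / 2) := by simp [phi]

lemma phi_le_phi_of_abs_le {x z : ℝ} (h : |x| ≤ |z|) : phi z ≤ phi x := by
  have := sq_le_sq.2 h
  unfold phi
  gcongr

lemma phi_le_phi_zero (x : ℝ) : phi x ≤ phi 0 := phi_le_phi_of_abs_le (by simp)

lemma hasDerivAt_phi (x : ℝ) : HasDerivAt phi (-x * phi x) x := by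
  have h : HasDerivAt (fun z : ℝ => -z ^ 2 / 2) (-x) x :=
    ((hasDerivAt_pow 2 x).neg.div_const 2).congr_deriv (by ring)
  exact (h.exp.const_mul (√(2 * π))⁻¹).congr_deriv (by unfold phi; ring)

/-- `z φ(z)` is maximal at `z = 1`. -/
lemma abs_mul_phi_le (z : ℝ) : |z| * phi z ≤ 0.242 := by
  have h1 : |z| ≤ exp ((z ^ 2 - 1) / 2) := by
    have := add_one_le_exp (z ^ 2 - 1)
    refine abs_le_of_sq_le_sq ?_ (exp_pos _).le
    rw [← exp_nat_mul, show ((2 : ℕ) : ℝ) * ((z ^ 2 - 1) / 2) = z ^ 2 - 1 by push_cast; ring]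
    linarith
  have h2 : |z| * phi z ≤ (√(2 * π))⁻¹ * exp (-(1 / 2)) := by
    calc |z| * phi z ≤ exp ((z ^ 2 - 1) / 2) * phi z := by
          gcongr; exact (phi_pos z).le
      _ = (√(2 * π))⁻¹ * (exp ((z ^ 2 - 1) / 2) * exp (-z ^ 2 / 2)) := by unfold phi; ring
      _ = _ := by rw [← exp_add]; congr 2; ring
  refine h2.trans ?_
  have h3 : ((√(2 * π))⁻¹ * exp (-(1 / 2))) ^ 2 ≤ 0.242 ^ 2 := by
    rw [mul_pow, inv_pow, sq_sqrt (by positivity), ← exp_nat_mul]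
    have : exp ((2 : ℕ) * -(1 / 2)) = (exp 1)⁻¹ := by rw [← exp_neg]; norm_num
    rw [this, ← mul_inv, inv_le_comm₀ (by positivity) (by norm_num)]
    have h1 := pi_gt_d4
    have h2 := exp_one_gt_d9
    nlinarith
  exact (pow_le_pow_iff_left₀ (by positivity) (by norm_num) two_ne_zero).1 h3

lemma nonneg_of_hasDerivAt_nonneg {F F' : ℝ → ℝ} {a : ℝ} (h0 : 0 ≤ F a)
    (hd : ∀ x, a ≤ x → HasDerivAt F (F' x) x) (hn : ∀ x, a ≤ x → 0 ≤ F' x) {x : ℝ} (hx : a ≤ x) :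
    0 ≤ F x := by
  have hm : MonotoneOn F (Set.Ici a) := by
    refine monotoneOn_of_deriv_nonneg (convex_Ici a)
      (fun z hz => (hd z hz).continuousAt.continuousWithinAt)
      (fun z hz => ?_) (fun z hz => ?_)
    · rw [interior_Ici] at hz
      exact (hd z (le_of_lt hz)).differentiableAt.differentiableWithinAt
    · rw [interior_Ici] at hz
      rw [(hd z (le_of_lt hz)).deriv]
      exact hn z (le_of_lt hz)
  exact h0.trans (hm (Set.mem_Ici.2 le_rfl) (Set.mem_Ici.2 hx) hx)

lemma hasDerivAt_Phi_const_add (τ v : ℝ) :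
    HasDerivAt (fun v => Phi (τ + v)) (phi (τ + v)) v :=
  (hasDerivAt_Phi (τ + v)).comp_const_add τ v

lemma hasDerivAt_phi_const_add (τ v : ℝ) :
    HasDerivAt (fun v => phi (τ + v)) (-(τ + v) * phi (τ + v)) v :=
  (hasDerivAt_phi (τ + v)).comp_const_add τ v

/-- Reduces an inequality for the Taylor remainder of `Phi` to increments of the nonnegative
sign, using the symmetry of the normal law. -/
lemma Phi_sub_eq (τ v : ℝ) : Phi (τ - v) = 1 - Phi (-τ + v) := by
  rw [← Phi_neg]; ring_nf

lemma Phi_le_linear {x : ℝ} (hx : 0 ≤ x) : Phi x ≤ 0.5 + 0.399 * x := by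
  have h := nonneg_of_hasDerivAt_nonneg (F := fun x => 1 / 2 + phi 0 * x - Phi x)
    (F' := fun x => phi 0 * 1 - phi x) (a := 0) (by simp [Phi_zero])
    (fun x _ => (((hasDerivAt_id x).const_mul (phi 0)).const_add (1 / 2)).sub (hasDerivAt_Phi x))
    (fun x _ => by linarith [phi_le_phi_zero x]) hx
  have := phi_zero_bounds.2
  nlinarith

lemma linear_le_Phi {x : ℝ} (hx : x ≤ 0) : 0.5 + 0.399 * x ≤ Phi x := by
  have h := Phi_le_linear (neg_nonneg.2 hx)
  rw [Phi_neg] at h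
  linarith

lemma one_sub_exp_neg_le {u : ℝ} (hu : 0 ≤ u) : 1 - exp (-u ^ 2 / 2) ≤ 0.456 * u := by
  have tangent (v c : ℝ) (hc : c ≤ exp (-v)) (huv : 0 ≤ 1 + v - u ^ 2 / 2) :
      c * (1 + v - u ^ 2 / 2) ≤ exp (-u ^ 2 / 2) := by
    have h := add_one_le_exp (v - u ^ 2 / 2)
    calc c * (1 + v - u ^ 2 / 2) ≤ exp (-v) * exp (v - u ^ 2 / 2) := by
          gcongr; linarith
      _ = _ := by rw [← exp_add]; congr 1; ring
  have e1 := exp_one_lt_d9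
  have e7 : (0.4965 : ℝ) ≤ exp (-0.7) := by
    have h : exp (-0.7) ^ 10 = (exp 1)⁻¹ ^ 7 := by
      rw [← exp_neg, ← exp_nat_mul, ← exp_nat_mul]; norm_num
    refine (pow_le_pow_iff_left₀ (by norm_num) (exp_pos _).le (n := 10) (by norm_num)).1 ?_
    rw [h]
    calc (0.4965 : ℝ) ^ 10 ≤ (2.7182818286)⁻¹ ^ 7 := by norm_num
      _ ≤ _ := by gcongr
  have e125 : (0.286 : ℝ) ≤ exp (-1.25) := by
    have h : exp (-1.25) ^ 4 = (exp 1)⁻¹ ^ 5 := by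
      rw [← exp_neg, ← exp_nat_mul, ← exp_nat_mul]; norm_num
    refine (pow_le_pow_iff_left₀ (by norm_num) (exp_pos _).le (n := 4) (by norm_num)).1 ?_
    rw [h]
    calc (0.286 : ℝ) ^ 4 ≤ (2.7182818286)⁻¹ ^ 5 := by norm_num
      _ ≤ _ := by gcongr
  have e2 : (0.135 : ℝ) ≤ exp (-2) := by
    have h : exp (-2) = (exp 1)⁻¹ ^ 2 := by
      rw [← exp_neg, ← exp_nat_mul]; norm_num
    rw [h]
    calc (0.135 : ℝ) ≤ (2.7182818286)⁻¹ ^ 2 := by norm_num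
      _ ≤ _ := by gcongr
  rcases le_total u 0.9 with h | h
  · nlinarith [add_one_le_exp (-u ^ 2 / 2)]
  rcases le_total u 1.375 with h' | h'
  · nlinarith [tangent 0.7 _ e7 (by nlinarith)]
  rcases le_total u 1.8 with h'' | h''
  · nlinarith [tangent 1.25 _ e125 (by nlinarith)]
  rcases le_total u 2.2 with h''' | h'''
  · nlinarith [tangent 2 _ e2 (by nlinarith)]
  · linarith [exp_pos (-u ^ 2 / 2)]

lemma phi_sub_phi_le {τ w : ℝ} (hτ : 0 ≤ τ) (hw : 0 ≤ w) : phi τ - phi (τ - w) ≤ 0.182 * w := by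
  rcases le_total w (2 * τ) with h | h
  · have : phi τ ≤ phi (τ - w) :=
      phi_le_phi_of_abs_le (by rw [abs_of_nonneg hτ, abs_le]; constructor <;> linarith)
    linarith
  · have h1 := phi_le_phi_zero τ
    have h2 := one_sub_exp_neg_le (u := w - τ) (by linarith)
    have h3 : phi (τ - w) = phi 0 * exp (-(w - τ) ^ 2 / 2) := by
      rw [phi_eq_phi_zero_mul]; congr 3; ring
    have h4 := phi_zero_bounds
    nlinarith

/-- Second-order upper bound for `Phi` around a nonnegative point. -/
lemma Phi_add_le_of_nonneg {τ : ℝ} (hτ : 0 ≤ τ) (v : ℝ) :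
    Phi (τ + v) ≤ Phi τ + phi τ * v + 0.091 * v ^ 2 := by
  rcases le_total 0 v with hv | hv
  · have h := nonneg_of_hasDerivAt_nonneg (F := fun v => phi τ * v - Phi (τ + v) + Phi τ)
      (F' := fun v => phi τ * 1 - phi (τ + v)) (a := 0) (by simp)
      (fun v _ => (((hasDerivAt_id v).const_mul (phi τ)).sub
        (hasDerivAt_Phi_const_add τ v)).add_const _)
      (fun v hv => by
        have : phi (τ + v) ≤ phi τ := phi_le_phi_of_abs_le (by
          rw [abs_of_nonneg hτ, abs_of_nonneg (by linarith)]; linarith)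
        linarith) hv
    nlinarith
  · have h := nonneg_of_hasDerivAt_nonneg
      (F := fun w => 0.091 * w ^ 2 - phi τ * w + Phi (-τ + w) + (Phi τ - 1))
      (F' := fun w => 0.091 * (2 * w) - phi τ * 1 + phi (-τ + w)) (a := 0)
      (by simp [Phi_neg])
      (fun w _ => by
        have := ((((hasDerivAt_pow 2 w).const_mul 0.091).sub
          ((hasDerivAt_id w).const_mul (phi τ))).add
          (hasDerivAt_Phi_const_add (-τ) w)).add_const (Phi τ - 1)
        simpa using this)
      (fun w hw => by
        have h := phi_sub_phi_le hτ hw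
        rw [← phi_neg (τ - w)] at h
        ring_nf at h ⊢
        linarith) (neg_nonneg.2 hv)
    have h2 := Phi_sub_eq τ (-v)
    rw [sub_neg_eq_add] at h2
    nlinarith

/-- Second-order upper bound for `Phi` around an arbitrary point. -/
lemma Phi_add_le (τ v : ℝ) : Phi (τ + v) ≤ Phi τ + phi τ * v + 0.121 * v ^ 2 := by
  have key (τ : ℝ) (ε : ℝ) (hε : |ε| = 1) (v : ℝ) (hv : 0 ≤ v) :
      0 ≤ 0.121 * v ^ 2 + ε * (Phi (τ + v) - Phi τ - phi τ * v) := by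
    refine nonneg_of_hasDerivAt_nonneg
      (F := fun v => 0.121 * v ^ 2 + ε * (Phi (τ + v) - Phi τ - phi τ * v))
      (F' := fun v => 0.242 * v + ε * (phi (τ + v) - phi τ)) (a := 0) (by simp)
      (fun v _ => ?_) (fun v hv => ?_) hv
    · have := ((hasDerivAt_pow 2 v).const_mul 0.121).add
        ((((hasDerivAt_Phi_const_add τ v).sub_const (Phi τ)).sub
          ((hasDerivAt_id v).const_mul (phi τ))).const_mul ε)
      exact this.congr_deriv (by norm_num; ring)
    · refine nonneg_of_hasDerivAt_nonneg
        (F := fun v => 0.242 * v + ε * (phi (τ + v) - phi τ))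
        (F' := fun v => 0.242 * 1 + ε * (-(τ + v) * phi (τ + v))) (a := 0) (by simp)
        (fun v _ => ((hasDerivAt_id v).const_mul 0.242).add
          (((hasDerivAt_phi_const_add τ v).sub_const (phi τ)).const_mul ε)) (fun v _ => ?_) hv
      have h := abs_mul_phi_le (τ + v)
      have h2 : |ε * (-(τ + v) * phi (τ + v))| ≤ 0.242 := by
        rw [abs_mul, hε, abs_mul, abs_neg, abs_of_pos (phi_pos _), one_mul]; exact h
      linarith [(abs_le.1 h2).1]
  rcases le_total 0 v with hv | hv
  · linarith [key τ (-1) (by simp) v hv]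
  · have h := key (-τ) 1 (by simp) (-v) (by linarith)
    have h2 := Phi_sub_eq τ (-v)
    rw [sub_neg_eq_add] at h2
    rw [Phi_neg, phi_neg] at h
    linarith

lemma quadratic_le_Phi {x : ℝ} (hx : 0 ≤ x) : 0.5 + 0.3989 * x - 0.091 * x ^ 2 ≤ Phi x := by
  have h := Phi_add_le_of_nonneg le_rfl (-x)
  rw [zero_add, Phi_neg, Phi_zero] at h
  nlinarith [phi_zero_bounds.1]

lemma cubic_le_Phi {x : ℝ} (hx : 0 ≤ x) : 0.5 + 0.3989 * x - 0.0665 * x ^ 3 ≤ Phi x := by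
  have h := nonneg_of_hasDerivAt_nonneg
    (F := fun x => Phi x - (1 / 2 + phi 0 * (x - x ^ 3 / 6)))
    (F' := fun x => phi x - phi 0 * (1 - x ^ 2 / 2)) (a := 0) (by simp [Phi_zero])
    (fun x _ => by
      have := (hasDerivAt_Phi x).sub ((((hasDerivAt_id x).sub
        ((hasDerivAt_pow 3 x).div_const 6)).const_mul (phi 0)).const_add (1 / 2))
      exact this.congr_deriv (by norm_num; left; ring))
    (fun x _ => by
      rw [phi_eq_phi_zero_mul x]
      have := add_one_le_exp (-x ^ 2 / 2)
      nlinarith [phi_pos 0]) hx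
  have h0 := phi_zero_bounds
  have h3 : 0 ≤ x ^ 3 := by positivity
  nlinarith

lemma exp_sq_div_two_ge (z : ℝ) : 1 + z ^ 2 / 2 + z ^ 4 / 8 ≤ exp (z ^ 2 / 2) := by
  have := quadratic_le_exp_of_nonneg (x := z ^ 2 / 2) (by positivity)
  linarith [this, (by ring : (z ^ 2 / 2) ^ 2 / 2 = z ^ 4 / 8)]

lemma phi_mul_exp (z : ℝ) : phi z * exp (z ^ 2 / 2) = phi 0 := by
  rw [phi_eq_phi_zero_mul z, mul_assoc, ← exp_add]
  ring_nf; simp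

lemma abs_sq_sub_one_mul_phi_le (z : ℝ) : |(z ^ 2 - 1) * phi z| ≤ 0.399 := by
  have h1 := exp_sq_div_two_ge z
  have h : |z ^ 2 - 1| ≤ exp (z ^ 2 / 2) := by
    rw [abs_le]; constructor <;> nlinarith [sq_nonneg (z ^ 2 - 2)]
  rw [abs_mul, abs_of_pos (phi_pos z)]
  have := phi_mul_exp z
  nlinarith [phi_zero_bounds.2, phi_pos z]

/-- Third-order upper bound for `Phi`. -/
lemma Phi_add_le_cubic (τ v : ℝ) :
    Phi (τ + v) ≤ Phi τ + phi τ * v - τ * phi τ * v ^ 2 / 2 + 0.0665 * |v| ^ 3 := by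
  have key (τ : ℝ) (ε : ℝ) (hε : |ε| = 1) (v : ℝ) (hv : 0 ≤ v) :
      0 ≤ 0.0665 * v ^ 3 + ε * (Phi (τ + v) - Phi τ - phi τ * v + τ * phi τ * v ^ 2 / 2) := by
    refine nonneg_of_hasDerivAt_nonneg
      (F := fun v => 0.0665 * v ^ 3 +
        ε * (Phi (τ + v) - Phi τ - phi τ * v + τ * phi τ * v ^ 2 / 2))
      (F' := fun v => 0.1995 * v ^ 2 + ε * (phi (τ + v) - phi τ + τ * phi τ * v)) (a := 0)
      (by simp) (fun v _ => ?_) (fun v hv => ?_) hv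
    · have := ((hasDerivAt_pow 3 v).const_mul 0.0665).add
        (((((hasDerivAt_Phi_const_add τ v).sub_const (Phi τ)).sub
          ((hasDerivAt_id v).const_mul (phi τ))).add
          (((hasDerivAt_pow 2 v).const_mul (τ * phi τ)).div_const 2)).const_mul ε)
      exact this.congr_deriv (by norm_num; ring)
    refine nonneg_of_hasDerivAt_nonneg
      (F := fun v => 0.1995 * v ^ 2 + ε * (phi (τ + v) - phi τ + τ * phi τ * v))
      (F' := fun v => 0.399 * v + ε * (-(τ + v) * phi (τ + v) + τ * phi τ)) (a := 0)
      (by simp) (fun v _ => ?_) (fun v hv => ?_) hv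
    · have := ((hasDerivAt_pow 2 v).const_mul 0.1995).add
        ((((hasDerivAt_phi_const_add τ v).sub_const (phi τ)).add
          ((hasDerivAt_id v).const_mul (τ * phi τ))).const_mul ε)
      exact this.congr_deriv (by norm_num; ring)
    refine nonneg_of_hasDerivAt_nonneg
      (F := fun v => 0.399 * v + ε * (-(τ + v) * phi (τ + v) + τ * phi τ))
      (F' := fun v => 0.399 + ε * (((τ + v) ^ 2 - 1) * phi (τ + v))) (a := 0)
      (by simp) (fun v _ => ?_) (fun v _ => ?_) hv
    · have := ((hasDerivAt_id v).const_mul 0.399).add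
        (((((hasDerivAt_id v).const_add τ).neg.mul
          (hasDerivAt_phi_const_add τ v)).add_const (τ * phi τ)).const_mul ε)
      exact this.congr_deriv (by simp only [Pi.neg_apply, id]; ring)
    have h2 : |ε * (((τ + v) ^ 2 - 1) * phi (τ + v))| ≤ 0.399 := by
      rw [abs_mul, hε, one_mul]; exact abs_sq_sub_one_mul_phi_le _
    linarith [(abs_le.1 h2).1]
  rcases le_total 0 v with hv | hv
  · rw [abs_of_nonneg hv]
    linarith [key τ (-1) (by simp) v hv]
  · have h := key (-τ) 1 (by simp) (-v) (by linarith)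
    have h2 := Phi_sub_eq τ (-v)
    rw [sub_neg_eq_add] at h2
    rw [Phi_neg, phi_neg] at h
    rw [abs_of_nonpos hv]
    nlinarith

lemma hasDerivAt_Phi_mul (y l : ℝ) : HasDerivAt (fun l => Phi (l * y)) (y * phi (l * y)) l :=
  ((hasDerivAt_Phi (l * y)).comp l ((hasDerivAt_id l).mul_const y)).congr_deriv (by ring)

lemma hasDerivAt_phi_mul (y l : ℝ) :
    HasDerivAt (fun l => phi (l * y)) (-(l * y ^ 2) * phi (l * y)) l := by
  have := HasDerivAt.comp (h₂ := phi) (h := fun l => l * y) l (hasDerivAt_phi (l * y))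
    ((hasDerivAt_id l).mul_const y)
  exact this.congr_deriv (by ring)

/-- First-order effect of rescaling on the normal distribution function. -/
lemma Phi_mul_le {y l : ℝ} (hl : 1 ≤ l) : Phi (l * y) ≤ Phi y + 0.121 * (l - l⁻¹) := by
  have h := nonneg_of_hasDerivAt_nonneg
    (F := fun l => Phi y + 0.121 * (l - l⁻¹) - Phi (l * y))
    (F' := fun l => 0.121 * (1 + (l ^ 2)⁻¹) - y * phi (l * y)) (a := 1) (by simp)
    (fun l hl => by
      have hl0 : l ≠ 0 := by positivity
      have := ((((hasDerivAt_id l).sub (hasDerivAt_inv hl0)).const_mul 0.121).const_add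
        (Phi y)).sub (hasDerivAt_Phi_mul y l)
      exact this.congr_deriv (by ring))
    (fun l hl => by
      have hl0 : 0 < l := by linarith
      have h1 : y * phi (l * y) ≤ 0.242 * l⁻¹ := by
        rw [← div_eq_mul_inv, le_div_iff₀ hl0]
        have := abs_mul_phi_le (l * y)
        nlinarith [le_abs_self (l * y), phi_pos (l * y)]
      have h2 : (l ^ 2)⁻¹ = l⁻¹ ^ 2 := by rw [inv_pow]
      rw [h2]
      nlinarith [sq_nonneg (l⁻¹ - 1)]) hl
  linarith

/-- Second-order effect of rescaling on the normal distribution function. -/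
lemma Phi_mul_sub_le {y l : ℝ} (hl : 1 ≤ l) :
    Phi (l * y) - y * (l ^ 3 - l) * phi (l * y) / 2 ≤ Phi y + (l ^ 2 - 1) ^ 2 / 4 := by
  have h := nonneg_of_hasDerivAt_nonneg
    (F := fun l => (l ^ 2 - 1) ^ 2 / 4 - (Phi (l * y) - y * (l ^ 3 - l) * phi (l * y) / 2) + Phi y)
    (F' := fun l => l * (l ^ 2 - 1) - y * (l ^ 2 - 1) * ((l * y) ^ 2 - 3) * phi (l * y) / 2)
    (a := 1) (by simp)
    (fun l hl => by
      have := ((((((hasDerivAt_pow 2 l).sub_const 1).pow 2).div_const 4).sub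
        ((hasDerivAt_Phi_mul y l).sub (((((hasDerivAt_pow 3 l).sub
          (hasDerivAt_id l)).const_mul y).mul (hasDerivAt_phi_mul y l)).div_const 2))).add_const
          (Phi y))
      exact this.congr_deriv (by simp; ring))
    (fun l hl => by
      have hl0 : 0 < l := by linarith
      set z := l * y with hz
      have h1 : z * (z ^ 2 - 3) * phi z ≤ 2 := by
        have h1 := exp_sq_div_two_ge z
        have h2 : z * (z ^ 2 - 3) ≤ 5 * exp (z ^ 2 / 2) := by
          nlinarith [sq_nonneg (z * (z / 2 - 1)), sq_nonneg (z + 1), sq_nonneg (z ^ 2)]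
        have := phi_mul_exp z
        nlinarith [phi_zero_bounds.2, phi_pos z]
      have h2 : 0 ≤ l ^ 2 - 1 := by nlinarith
      have h3 : l * (y * (z ^ 2 - 3) * phi z) ≤ l * (2 * l) := by
        calc l * (y * (z ^ 2 - 3) * phi z) = z * (z ^ 2 - 3) * phi z := by rw [hz]; ring
          _ ≤ 2 := h1
          _ ≤ _ := by nlinarith
      have h4 := le_of_mul_le_mul_left h3 hl0
      nlinarith) hl
  linarith

section Moments

variable {Ω : Type*} {mΩ : MeasurableSpace Ω} {P : Measure Ω} [IsProbabilityMeasure P]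
  {X : Ω → ℝ} {s V : ℝ}

lemma integrable_of_integrable_abs_cube (hX : Measurable X)
    (h3 : Integrable (fun ω => |X ω| ^ 3) P) : Integrable X P := by
  refine ((integrable_const 1).add h3).mono' hX.aestronglyMeasurable (ae_of_all _ fun ω => ?_)
  simp only [Pi.add_apply, norm_eq_abs]
  nlinarith [abs_nonneg (X ω), sq_nonneg (|X ω| - 1), sq_nonneg (|X ω|),
    mul_nonneg (abs_nonneg (X ω)) (sq_nonneg (|X ω| - 1))]

lemma integrable_sq_of_integrable_abs_cube (hX : Measurable X)
    (h3 : Integrable (fun ω => |X ω| ^ 3) P) : Integrable (fun ω => X ω ^ 2) P := by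
  refine ((integrable_const 1).add h3).mono' (hX.pow_const 2).aestronglyMeasurable
    (ae_of_all _ fun ω => ?_)
  simp only [Pi.add_apply, norm_eq_abs]
  rw [abs_pow]
  nlinarith [abs_nonneg (X ω), sq_nonneg (|X ω| - 1),
    mul_nonneg (abs_nonneg (X ω)) (sq_nonneg (|X ω| - 1))]

lemma cube_le_integral_abs_cube {a : ℝ} (ha : 0 ≤ a) (hX : Measurable X)
    (h2 : ∫ ω, X ω ^ 2 ∂P = a ^ 2) (h3 : Integrable (fun ω => |X ω| ^ 3) P) :
    a ^ 3 ≤ ∫ ω, |X ω| ^ 3 ∂P := by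
  have hi2 := integrable_sq_of_integrable_abs_cube hX h3
  have h : ∫ ω, (1.5 * a * X ω ^ 2 - 0.5 * a ^ 3) ∂P ≤ ∫ ω, |X ω| ^ 3 ∂P := by
    refine integral_mono ((hi2.const_mul _).sub (integrable_const _)) h3 fun ω => ?_
    simp only
    rw [← sq_abs (X ω)]
    nlinarith [mul_nonneg (abs_nonneg (X ω)) (sq_nonneg (|X ω| - a)),
      mul_nonneg ha (sq_nonneg (|X ω| - a))]
  rw [integral_sub (hi2.const_mul _) (integrable_const _), integral_const_mul, h2] at h
  simp at h
  nlinarith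

lemma integrable_Phi_comp (hX : Measurable X) (y : ℝ) :
    Integrable (fun ω => Phi ((y - X ω) / s)) P := by
  refine (integrable_const (1 : ℝ)).mono'
    (continuous_Phi.measurable.comp ((hX.const_sub y).div_const s)).aestronglyMeasurable
    (ae_of_all _ fun ω => ?_)
  rw [norm_eq_abs, abs_of_nonneg (Phi_nonneg _)]
  exact Phi_le_one _

/-- Integrating a pointwise bound of third order against a centered law. -/
lemma integral_Phi_le_of_le_cubic {y A B C D : ℝ} (hX : Measurable X) (h1 : ∫ ω, X ω ∂P = 0)
    (h2 : ∫ ω, X ω ^ 2 ∂P = V) (h3 : Integrable (fun ω => |X ω| ^ 3) P)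
    (h : ∀ x, Phi ((y - x) / s) ≤ A + B * x + C * x ^ 2 + D * |x| ^ 3) :
    ∫ ω, Phi ((y - X ω) / s) ∂P ≤ A + C * V + D * ∫ ω, |X ω| ^ 3 ∂P := by
  have hi1 := integrable_of_integrable_abs_cube hX h3
  have hi2 := integrable_sq_of_integrable_abs_cube hX h3
  have i1 : Integrable (fun ω => A + B * X ω) P := (integrable_const A).add (hi1.const_mul B)
  have i2 : Integrable (fun ω => A + B * X ω + C * X ω ^ 2) P := i1.add (hi2.const_mul C)
  have i3 : Integrable (fun ω => A + B * X ω + C * X ω ^ 2 + D * |X ω| ^ 3) P :=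
    i2.add (h3.const_mul D)
  refine (integral_mono (integrable_Phi_comp hX y) i3 fun ω => h (X ω)).trans_eq ?_
  rw [integral_add i2 (h3.const_mul D), integral_add i1 (hi2.const_mul C),
    integral_add (integrable_const A) (hi1.const_mul B), integral_const_mul, integral_const_mul,
    integral_const_mul, h1, h2]
  simp

/-- The regime of a dominating Gaussian part. -/
lemma integral_Phi_le_of_large_scale {y a : ℝ} (ha : 0 ≤ a) (hs : 0 < s)
    (has : a ^ 2 + s ^ 2 = 1) (hs7 : 0.7 ≤ s ^ 2) (hX : Measurable X) (h1 : ∫ ω, X ω ∂P = 0)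
    (h2 : ∫ ω, X ω ^ 2 ∂P = a ^ 2) (h3 : Integrable (fun ω => |X ω| ^ 3) P) :
    ∫ ω, Phi ((y - X ω) / s) ∂P ≤ Phi y + 0.56 * ∫ ω, |X ω| ^ 3 ∂P := by
  have hβ := cube_le_integral_abs_cube ha hX h2 h3
  have h := integral_Phi_le_of_le_cubic (s := s) (y := y) (A := Phi (s⁻¹ * y))
    (B := -phi (s⁻¹ * y) * s⁻¹) (C := -(s⁻¹ * y * phi (s⁻¹ * y) * s⁻¹ ^ 2 / 2))
    (D := 0.0665 * s⁻¹ ^ 3) hX h1 h2 h3 fun x => by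
      have := Phi_add_le_cubic (s⁻¹ * y) (-(s⁻¹ * x))
      rw [abs_neg, abs_mul, abs_of_pos (inv_pos.2 hs), mul_pow] at this
      rw [show (y - x) / s = s⁻¹ * y + -(s⁻¹ * x) by field_simp; ring]
      linarith
  set β := ∫ ω, |X ω| ^ 3 ∂P
  have hs1 : s ≤ 1 := by nlinarith
  have hs8 : 0.83 ≤ s := by nlinarith
  have hl1 : 1 ≤ s⁻¹ := (one_le_inv₀ hs).2 hs1
  have hm := Phi_mul_sub_le (y := y) hl1
  have hl : s⁻¹ * s = 1 := inv_mul_cancel₀ hs.ne'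
  have ha2 : s⁻¹ ^ 2 * a ^ 2 = s⁻¹ ^ 2 - 1 := by
    rw [show a ^ 2 = 1 - s ^ 2 by linarith]
    linear_combination (-s⁻¹ * s - 1) * hl
  have hl2 : s⁻¹ ^ 2 ≤ 1.43 := by
    have : s⁻¹ ^ 2 * s ^ 2 = 1 := by rw [← mul_pow, hl, one_pow]
    nlinarith [sq_nonneg s⁻¹]
  have hl3 : s⁻¹ ≤ 1.21 := by nlinarith
  have ha5 : a ≤ 0.55 := by nlinarith
  have hl4 : s⁻¹ ^ 3 ≤ 1.74 := by nlinarith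
  have hm2 : (s⁻¹ ^ 2 - 1) ^ 2 / 4 ≤ 0.29 * a ^ 3 := by
    rw [← ha2]
    have e1 : (s⁻¹ ^ 2 * a ^ 2) ^ 2 / 4 = (s⁻¹ ^ 2) ^ 2 * (a * a ^ 3) / 4 := by ring
    have e2 : (s⁻¹ ^ 2) ^ 2 ≤ 2.05 := by nlinarith [sq_nonneg s⁻¹]
    have e3 : a * a ^ 3 ≤ 0.55 * a ^ 3 := by gcongr
    have e4 : 0 ≤ a * a ^ 3 := by positivity
    rw [e1]
    nlinarith [pow_nonneg ha 3]
  have hβ0 : 0 ≤ β := (pow_nonneg ha 3).trans hβ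
  have e5 : 0.0665 * s⁻¹ ^ 3 * β ≤ 0.0665 * 1.74 * β := by gcongr
  have e6 : -(s⁻¹ * y * phi (s⁻¹ * y) * s⁻¹ ^ 2 / 2) * a ^ 2
      = -(y * (s⁻¹ ^ 3 - s⁻¹) * phi (s⁻¹ * y) / 2) := by
    linear_combination (-(s⁻¹ * y * phi (s⁻¹ * y)) / 2) * ha2
  rw [e6] at h
  linarith

/-- The regime of balanced scales at a nonpositive point. -/
lemma integral_Phi_le_of_nonpos {y a : ℝ} (ha : 0 ≤ a) (hs : 0 < s)
    (has : a ^ 2 + s ^ 2 = 1) (hs2 : 0.25 ≤ s ^ 2) (hs7 : s ^ 2 ≤ 0.7) (hy : y ≤ 0)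
    (hX : Measurable X) (h1 : ∫ ω, X ω ∂P = 0)
    (h2 : ∫ ω, X ω ^ 2 ∂P = a ^ 2) (h3 : Integrable (fun ω => |X ω| ^ 3) P) :
    ∫ ω, Phi ((y - X ω) / s) ∂P ≤ Phi y + 0.56 * ∫ ω, |X ω| ^ 3 ∂P := by
  have hβ := cube_le_integral_abs_cube ha hX h2 h3
  have h := integral_Phi_le_of_le_cubic (s := s) (y := y) (A := Phi (s⁻¹ * y))
    (B := -phi (s⁻¹ * y) * s⁻¹) (C := 0.121 * s⁻¹ ^ 2) (D := 0) hX h1 h2 h3 fun x => by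
      have := Phi_add_le (s⁻¹ * y) (-(s⁻¹ * x))
      rw [show (y - x) / s = s⁻¹ * y + -(s⁻¹ * x) by field_simp; ring]
      linarith
  have hs1 : s ≤ 1 := by nlinarith
  have hl1 : 1 ≤ s⁻¹ := (one_le_inv₀ hs).2 hs1
  have hm : Phi (s⁻¹ * y) ≤ Phi y := monotone_Phi (by nlinarith)
  have hb : 0.121 ≤ 0.56 * (a * s ^ 2) := by
    have : 0.04687 ≤ (a * s ^ 2) ^ 2 := by
      rw [mul_pow, show a ^ 2 = 1 - s ^ 2 by linarith]
      nlinarith [mul_nonneg (sub_nonneg.2 hs2) (sub_nonneg.2 hs7),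
        mul_nonneg (mul_nonneg (sub_nonneg.2 hs2) (sub_nonneg.2 hs7)) (sq_nonneg s)]
    nlinarith [show 0 ≤ a * s ^ 2 by positivity]
  have hc : 0.121 * s⁻¹ ^ 2 * a ^ 2 ≤ 0.56 * a ^ 3 := by
    calc 0.121 * s⁻¹ ^ 2 * a ^ 2 ≤ 0.56 * (a * s ^ 2) * s⁻¹ ^ 2 * a ^ 2 := by gcongr
      _ = 0.56 * a ^ 3 := by field_simp
  linarith

/-- The regime of balanced scales at a nonnegative point. -/
lemma integral_Phi_le_of_nonneg {y a : ℝ} (ha : 0 ≤ a) (hs : 0 < s)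
    (has : a ^ 2 + s ^ 2 = 1) (hs3 : 0.38 ≤ s ^ 2) (hs7 : s ^ 2 ≤ 0.7) (hy : 0 ≤ y)
    (hX : Measurable X) (h1 : ∫ ω, X ω ∂P = 0)
    (h2 : ∫ ω, X ω ^ 2 ∂P = a ^ 2) (h3 : Integrable (fun ω => |X ω| ^ 3) P) :
    ∫ ω, Phi ((y - X ω) / s) ∂P ≤ Phi y + 0.56 * ∫ ω, |X ω| ^ 3 ∂P := by
  have hβ := cube_le_integral_abs_cube ha hX h2 h3
  have h := integral_Phi_le_of_le_cubic (s := s) (y := y) (A := Phi (s⁻¹ * y))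
    (B := -phi (s⁻¹ * y) * s⁻¹) (C := 0.091 * s⁻¹ ^ 2) (D := 0) hX h1 h2 h3 fun x => by
      have := Phi_add_le_of_nonneg (τ := s⁻¹ * y) (by positivity) (-(s⁻¹ * x))
      rw [show (y - x) / s = s⁻¹ * y + -(s⁻¹ * x) by field_simp; ring]
      linarith
  have hs1 : s ≤ 1 := by nlinarith
  have hl1 : 1 ≤ s⁻¹ := (one_le_inv₀ hs).2 hs1
  have hm := Phi_mul_le (y := y) hl1
  rw [inv_inv] at hm
  have hls : s⁻¹ - s = s * (s⁻¹ ^ 2 * a ^ 2) := by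
    rw [show a ^ 2 = 1 - s ^ 2 by linarith]
    field_simp
  have hb : 0.121 * s + 0.091 ≤ 0.56 * (a * s ^ 2) := by
    refine le_of_sq_le_sq ?_ (by positivity)
    rw [mul_pow, mul_pow, show a ^ 2 = 1 - s ^ 2 by linarith]
    nlinarith [sq_nonneg (s - 0.7), mul_nonneg (sub_nonneg.2 hs3) (sub_nonneg.2 hs7),
      mul_nonneg (mul_nonneg (sub_nonneg.2 hs3) (sub_nonneg.2 hs7)) (sq_nonneg s)]
  have hc : (0.121 * s + 0.091) * s⁻¹ ^ 2 * a ^ 2 ≤ 0.56 * a ^ 3 := by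
    calc (0.121 * s + 0.091) * s⁻¹ ^ 2 * a ^ 2 ≤ 0.56 * (a * s ^ 2) * s⁻¹ ^ 2 * a ^ 2 := by gcongr
      _ = 0.56 * a ^ 3 := by field_simp
  rw [hls] at hm
  linarith

end Moments

/-- A quadratic minorant of the normal distribution function for one slope gives minorants for
all smaller slopes. -/
lemma quadratic_profile_le_Phi {ρ κ ν₀ ν : ℝ} (hκ : 0 ≤ κ) (hν₀ : 0 < ν₀) (hν : 0 ≤ ν)
    (hνν : ν ≤ ν₀)
    (h : ∀ w, 0 ≤ w → ν₀ * w ≤ 1 → κ * (2 * (ν₀ * w) - (ν₀ * w) ^ 2) ≤ Phi (w - ρ)) (w : ℝ) :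
    κ * (2 * (ν * w) - (ν * w) ^ 2) ≤ Phi (w - ρ) := by
  rcases le_total w 0 with hw | hw
  · refine le_trans ?_ (Phi_nonneg _)
    have : ν * w ≤ 0 := mul_nonpos_of_nonneg_of_nonpos hν hw
    exact mul_nonpos_of_nonneg_of_nonpos hκ (by nlinarith)
  rcases le_total (ν₀ * w) 1 with hw1 | hw1
  · refine le_trans (mul_le_mul_of_nonneg_left ?_ hκ) (h w hw hw1)
    have : ν * w ≤ ν₀ * w := mul_le_mul_of_nonneg_right hνν hw
    nlinarith
  · have h1 := h ν₀⁻¹ (by positivity) (by rw [mul_inv_cancel₀ hν₀.ne'])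
    rw [mul_inv_cancel₀ hν₀.ne'] at h1
    have h2 : Phi (ν₀⁻¹ - ρ) ≤ Phi (w - ρ) := by
      refine monotone_Phi (sub_le_sub_right ?_ _)
      rwa [inv_le_iff_one_le_mul₀' hν₀]
    nlinarith [mul_nonneg hκ (sq_nonneg (ν * w - 1))]

/-- Cantelli-type bound for a smoothed distribution function. -/
lemma integral_Phi_le_one_sub {Ω : Type*} {mΩ : MeasurableSpace Ω} {P : Measure Ω}
    [IsProbabilityMeasure P] {X : Ω → ℝ} {s a y p ρ κ ν₀ : ℝ} (ha : 0 < a) (hs : 0 < s)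
    (hX : Measurable X) (h1 : ∫ ω, X ω ∂P = 0)
    (h2 : ∫ ω, X ω ^ 2 ∂P = a ^ 2) (h3 : Integrable (fun ω => |X ω| ^ 3) P)
    (hκ : 0 ≤ κ) (hν₀ : 0 < ν₀) (hsa : s ≤ 2 * a * ν₀) (hp : 0 ≤ p) (hpy : p = ρ * s - y)
    (h : ∀ w, 0 ≤ w → ν₀ * w ≤ 1 → κ * (2 * (ν₀ * w) - (ν₀ * w) ^ 2) ≤ Phi (w - ρ)) :
    ∫ ω, Phi ((y - X ω) / s) ∂P ≤ 1 - κ * (p ^ 2 / (p ^ 2 + a ^ 2)) := by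
  set μ := p / (p ^ 2 + a ^ 2) with hμ
  have hpa : 0 < p ^ 2 + a ^ 2 := by positivity
  have hμ0 : 0 ≤ μ := by positivity
  have hμa : μ * (2 * a) ≤ 1 := by
    rw [hμ, div_mul_eq_mul_div, div_le_one hpa]
    nlinarith [sq_nonneg (p - a)]
  have hν : μ * s ≤ ν₀ := by
    calc μ * s ≤ μ * (2 * a * ν₀) := by gcongr
      _ = μ * (2 * a) * ν₀ := by ring
      _ ≤ 1 * ν₀ := by gcongr
      _ = ν₀ := one_mul _
  have hi := integral_Phi_le_of_le_cubic (s := s) (y := y)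
    (A := 1 - κ * (2 * μ * p - μ ^ 2 * p ^ 2)) (B := -κ * (2 * μ - 2 * μ ^ 2 * p))
    (C := κ * μ ^ 2) (D := 0) hX h1 h2 h3 fun x => by
      have h4 := quadratic_profile_le_Phi hκ hν₀ (mul_nonneg hμ0 hs.le) hν h ((x + p) / s)
      rw [show μ * s * ((x + p) / s) = μ * (x + p) by field_simp,
        show (x + p) / s - ρ = -((y - x) / s) by rw [hpy]; field_simp; ring, Phi_neg] at h4
      linarith
  refine hi.trans_eq ?_
  have e : μ * (p ^ 2 + a ^ 2) = p := by rw [hμ]; field_simp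
  have e2 : p ^ 2 / (p ^ 2 + a ^ 2) = μ * p := by rw [hμ]; ring
  rw [e2]
  linear_combination κ * μ * e

lemma cube_ge_of_sq_add_sq {a s : ℝ} (ha : 0 ≤ a) (has : a ^ 2 + s ^ 2 = 1) :
    1 - 1.5 * s ^ 2 + 0.375 * s ^ 4 ≤ a ^ 3 := by
  have h1 : a ≤ 1 := by nlinarith
  rw [show s ^ 4 = (s ^ 2) ^ 2 by ring, show s ^ 2 = 1 - a ^ 2 by linarith]
  have : 0 ≤ (1 - a) ^ 3 * (0.125 + 0.375 * a) := by
    have := pow_nonneg (sub_nonneg.2 h1) 3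
    positivity
  linarith

lemma Phi_profile_of_nonpos (w : ℝ) (hw : 0 ≤ w) (h : 0.289 * w ≤ 1) :
    0.9 * (2 * (0.289 * w) - (0.289 * w) ^ 2) ≤ Phi (w - 1.1) := by
  rcases le_total w 1.1 with h1 | h1
  · have := linear_le_Phi (x := w - 1.1) (by linarith)
    nlinarith [sq_nonneg (w - 0.8)]
  · have := quadratic_le_Phi (x := w - 1.1) (by linarith)
    nlinarith

lemma Phi_profile_of_nonneg (w : ℝ) :
    0.62 * (2 * (0.3915 * w) - (0.3915 * w) ^ 2) ≤ Phi (w - 1.2) := by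
  rcases le_total w 1.2 with h1 | h1
  · have := linear_le_Phi (x := w - 1.2) (by linarith)
    nlinarith [sq_nonneg (w - 0.455)]
  · have := quadratic_le_Phi (x := w - 1.2) (by linarith)
    nlinarith

/-- The numerical inequality for small scales at a nonpositive point. -/
lemma Phi_le_of_small_scale {a s t p : ℝ} (ha : 0 < a) (hs : 0 < s) (has : a ^ 2 + s ^ 2 = 1)
    (hs2 : s ^ 2 ≤ 0.25) (ht : 0 ≤ t) (hp : p = 1.1 * s + t) :
    Phi t ≤ 0.9 * (p ^ 2 / (p ^ 2 + a ^ 2)) + 0.56 * a ^ 3 := by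
  have h3 := cube_ge_of_sq_add_sq ha.le has
  have hs5 : s ≤ 0.5 := by nlinarith
  have ha1 : a ^ 2 ≤ 1 := by nlinarith
  have hm : p ^ 2 / (p ^ 2 + 1) ≤ p ^ 2 / (p ^ 2 + a ^ 2) := by gcongr
  have hp0 : 0 < p := by rw [hp]; positivity
  rcases le_total p 1.9 with hp1 | hp1
  · have h4 : (0.399 * p - 0.06) / 0.9 ≤ p ^ 2 / (p ^ 2 + 1) := by
      rw [div_le_div_iff₀ (by norm_num) (by positivity)]
      nlinarith [mul_nonneg hp0.le (sub_nonneg.2 hp1),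
        mul_nonneg (sub_nonneg.2 hp1) (sq_nonneg (p - 0.24)),
        mul_nonneg hp0.le (sq_nonneg (p - 0.24))]
    have h5 := Phi_le_linear ht
    rw [div_le_iff₀ (by norm_num)] at h4
    nlinarith [pow_nonneg hs.le 4]
  · have h4 : 0.783 ≤ p ^ 2 / (p ^ 2 + 1) := by
      rw [le_div_iff₀ (by positivity)]
      nlinarith
    have h5 := Phi_le_one t
    nlinarith [sq_nonneg (s ^ 2 - 0.25)]

/-- The numerical inequality for small scales at a nonnegative point. -/
lemma le_Phi_of_small_scale {a s y p : ℝ} (ha : 0 < a) (hs : 0 < s) (has : a ^ 2 + s ^ 2 = 1)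
    (hs2 : s ^ 2 ≤ 0.38) (hy : 0 ≤ y) (hp0 : 0 ≤ p) (hp : p = 1.2 * s - y) :
    1 - 0.62 * (p ^ 2 / (p ^ 2 + a ^ 2)) ≤ Phi y + 0.56 * a ^ 3 := by
  have h3 := cube_ge_of_sq_add_sq ha.le has
  have h4 := cubic_le_Phi hy
  have hs6 : s ≤ 0.6165 := by nlinarith
  have hm (m : ℝ) : 2 * m * p - m ^ 2 * (p ^ 2 + 1 - s ^ 2) ≤ p ^ 2 / (p ^ 2 + a ^ 2) := by
    rw [le_div_iff₀ (by positivity), show p ^ 2 + 1 - s ^ 2 = p ^ 2 + a ^ 2 by linarith]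
    nlinarith [sq_nonneg (p - m * (p ^ 2 + a ^ 2))]
  rcases le_total p 0.36 with hp1 | hp1
  · have h5 := hm 0.29
    have hy3 : y ^ 3 ≤ 0.74 * y ^ 2 := by nlinarith [sq_nonneg y]
    obtain rfl : y = 1.2 * s - p := by linarith
    rcases le_total s 0.5 with h | h
    · nlinarith [pow_nonneg hs.le 4, mul_nonneg hs.le (sub_nonneg.2 h), mul_nonneg hp0 hy,
        mul_nonneg hp0 (sub_nonneg.2 hp1), mul_nonneg hy (sub_nonneg.2 h), mul_nonneg hp0 hs.le,
        mul_nonneg hp0 (sub_nonneg.2 h)]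
    · nlinarith [sq_nonneg (s ^ 2 - 0.38), mul_nonneg (sub_nonneg.2 h) (sub_nonneg.2 hs6),
        mul_nonneg hp0 hy, mul_nonneg hp0 (sub_nonneg.2 hp1), mul_nonneg hy (sub_nonneg.2 hs6),
        mul_nonneg hp0 hs.le, mul_nonneg hp0 (sub_nonneg.2 hs6)]
  · have h5 := hm 0.6
    have hy3 : y ^ 3 ≤ 0.38 * y ^ 2 := by nlinarith [sq_nonneg y]
    obtain rfl : y = 1.2 * s - p := by linarith
    have h : 0.3 ≤ s := by linarith
    nlinarith [sq_nonneg (s ^ 2 - 0.3), mul_nonneg (sub_nonneg.2 h) (sub_nonneg.2 hs6),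
      mul_nonneg (sub_nonneg.2 hp1) hy, mul_nonneg hy (sub_nonneg.2 hs6),
      mul_nonneg (sub_nonneg.2 hp1) (sub_nonneg.2 hs6)]

lemma le_Phi_of_small_scale_of_lt {a s y : ℝ} (ha : 0 < a) (hs : 0 < s)
    (has : a ^ 2 + s ^ 2 = 1) (hs2 : s ^ 2 ≤ 0.38) (hy : 1.2 * s ≤ y) :
    1 ≤ Phi y + 0.56 * a ^ 3 := by
  have h := le_Phi_of_small_scale (y := 1.2 * s) (p := 0) ha hs has hs2 (by positivity) le_rfl
    (by ring)
  have := monotone_Phi hy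
  simp at h
  linarith

/-- One-sided normal approximation for a standardized sum with a Gaussian summand. -/
lemma integral_Phi_le {Ω : Type*} {mΩ : MeasurableSpace Ω} {P : Measure Ω}
    [IsProbabilityMeasure P] {X : Ω → ℝ} {s a : ℝ} (ha : 0 < a) (hs : 0 < s)
    (has : a ^ 2 + s ^ 2 = 1) (hX : Measurable X) (h1 : ∫ ω, X ω ∂P = 0)
    (h2 : ∫ ω, X ω ^ 2 ∂P = a ^ 2) (h3 : Integrable (fun ω => |X ω| ^ 3) P) (y : ℝ) :
    ∫ ω, Phi ((y - X ω) / s) ∂P ≤ Phi y + 0.56 * ∫ ω, |X ω| ^ 3 ∂P := by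
  have hβ := cube_le_integral_abs_cube ha.le hX h2 h3
  rcases le_total 0.7 (s ^ 2) with hs7 | hs7
  · exact integral_Phi_le_of_large_scale ha.le hs has hs7 hX h1 h2 h3
  rcases le_total y 0 with hy | hy
  · rcases le_total 0.25 (s ^ 2) with hs2 | hs2
    · exact integral_Phi_le_of_nonpos ha.le hs has hs2 hs7 hy hX h1 h2 h3
    have h4 := integral_Phi_le_one_sub (y := y) (p := 1.1 * s + -y) (ρ := 1.1) (κ := 0.9)
      (ν₀ := 0.289) ha hs hX h1 h2 h3 (by norm_num) (by norm_num)
      (abs_le_of_sq_le_sq' (by nlinarith) (by positivity)).2 (by nlinarith) (by ring)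
      Phi_profile_of_nonpos
    have h5 := Phi_le_of_small_scale ha hs has hs2 (neg_nonneg.2 hy) rfl
    rw [Phi_neg] at h5
    linarith
  · rcases le_total 0.38 (s ^ 2) with hs2 | hs2
    · exact integral_Phi_le_of_nonneg ha.le hs has hs2 hs7 hy hX h1 h2 h3
    rcases le_total (1.2 * s) y with hy2 | hy2
    · have h4 : ∫ ω, Phi ((y - X ω) / s) ∂P ≤ 1 := by
        refine (integral_mono (integrable_Phi_comp hX y) (integrable_const 1)
          fun ω => Phi_le_one _).trans_eq ?_
        simp
      linarith [le_Phi_of_small_scale_of_lt ha hs has hs2 hy2]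
    · have h4 := integral_Phi_le_one_sub (y := y) (p := 1.2 * s - y) (ρ := 1.2) (κ := 0.62)
        (ν₀ := 0.3915) ha hs hX h1 h2 h3 (by norm_num) (by norm_num)
        (abs_le_of_sq_le_sq' (by nlinarith) (by positivity)).2 (by linarith) (by ring)
        fun w _ _ => Phi_profile_of_nonneg w
      have h5 := le_Phi_of_small_scale ha hs has hs2 hy (sub_nonneg.2 hy2) rfl
      linarith

lemma cdf_gaussianReal_zero {v : NNReal} (hv : v ≠ 0) (x : ℝ) :
    cdf (gaussianReal 0 v) x = Phi (x / √v) := by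
  have hv0 : 0 < √(v : ℝ) := Real.sqrt_pos.2 (by positivity)
  have h : gaussianReal 0 v = (gaussianReal 0 1).map (√(v : ℝ) * ·) := by
    rw [gaussianReal_map_const_mul, mul_zero]
    congr 1
    ext
    simp
  rw [Phi, cdf_eq_real, cdf_eq_real, h, map_measureReal_apply (by fun_prop) measurableSet_Iic]
  congr 1
  ext z
  simp only [Set.mem_preimage, Set.mem_Iic]
  rw [le_div_iff₀ hv0, mul_comm]

/-- The distribution function of a sum with an independent centered Gaussian summand. -/
lemma cdf_map_add_div {Ω : Type*} {mΩ : MeasurableSpace Ω} {P : Measure Ω}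
    [IsProbabilityMeasure P] {L G : Ω → ℝ} {v : NNReal} {S : ℝ} (hv : v ≠ 0) (hS : 0 < S)
    (hL : Measurable L) (hG : Measure.map G P = gaussianReal 0 v) (hLG : IndepFun L G P) (y : ℝ) :
    cdf (Measure.map (fun ω => (L ω + G ω) / S) P) y
      = ∫ ω, Phi ((y - L ω / S) / (√v / S)) ∂P := by
  have hGm : AEMeasurable G P := by
    by_contra hc
    have h0 := hG
    rw [Measure.map_of_not_aemeasurable hc] at h0
    exact IsProbabilityMeasure.ne_zero (gaussianReal 0 v) h0.symm
  have hprod := (indepFun_iff_map_prod_eq_prod_map_map hL.aemeasurable hGm).1 hLG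
  have hLp : IsProbabilityMeasure (P.map L) := Measure.isProbabilityMeasure_map hL.aemeasurable
  have hYp : IsProbabilityMeasure (P.map fun ω => (L ω + G ω) / S) :=
    Measure.isProbabilityMeasure_map ((hL.aemeasurable.add hGm).div_const S)
  have hg : Measurable fun z : ℝ × ℝ => (z.1 + z.2) / S := by fun_prop
  have hmap : P.map (fun ω => (L ω + G ω) / S)
      = ((P.map L).prod (gaussianReal 0 v)).map fun z : ℝ × ℝ => (z.1 + z.2) / S := by
    rw [← hG, ← hprod, AEMeasurable.map_map_of_aemeasurable hg.aemeasurable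
      (hL.aemeasurable.prodMk hGm)]
    rfl
  have hsec (x : ℝ) : Prod.mk x ⁻¹' ((fun z : ℝ × ℝ => (z.1 + z.2) / S) ⁻¹' Set.Iic y)
      = Set.Iic (y * S - x) := by
    ext z
    simp only [Set.mem_preimage, Set.mem_Iic]
    rw [div_le_iff₀ hS]
    constructor <;> intro h <;> linarith
  rw [cdf_eq_real, hmap, map_measureReal_apply hg measurableSet_Iic, measureReal_def,
    Measure.prod_apply (hg measurableSet_Iic)]
  simp only [hsec]
  have hx (x : ℝ) : gaussianReal 0 v (Set.Iic (y * S - x))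
      = ENNReal.ofReal (Phi ((y - x / S) / (√v / S))) := by
    rw [← ofReal_cdf, cdf_gaussianReal_zero hv]
    congr 2
    field_simp
  simp only [hx]
  have hm : Measurable fun x : ℝ => Phi ((y - x / S) / (√v / S)) :=
    continuous_Phi.measurable.comp (by fun_prop)
  rw [← integral_map (f := fun x : ℝ => Phi ((y - x / S) / (√v / S))) hL.aemeasurable
    hm.aestronglyMeasurable, integral_eq_lintegral_of_nonneg_ae
    (ae_of_all _ fun x => Phi_nonneg _) hm.aestronglyMeasurable]

/-- Gaussian approximation of the sum of an arbitrary centered random variable `L̃` with a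
finite third absolute moment and an independent centered Gaussian `G̃`: the CDF of the
normalized sum `Y = (L̃ + G̃)/√(σ_L² + σ_G²)` is uniformly within
`τ = 0.56 · E|L̃|³ / (√(σ_L² + σ_G²))³` of the standard normal CDF. -/
theorem gaussian_approx_sum
    {Ω : Type*} [MeasureSpace Ω] [IsProbabilityMeasure (ℙ : Measure Ω)]
    (Lt Gt : Ω → ℝ) (σL2 σG2 : ℝ) (hσL : 0 < σL2) (hσG : 0 < σG2)
    (hLmeas : Measurable Lt)
    (hLmean : ∫ ω, Lt ω = 0)
    (hLvar : ∫ ω, (Lt ω) ^ 2 = σL2)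
    (hL3 : Integrable (fun ω => |Lt ω| ^ 3) ℙ)
    (hG : Measure.map Gt ℙ = gaussianReal 0 ⟨σG2, hσG.le⟩)
    (hindep : IndepFun Lt Gt ℙ)
    (y : ℝ) :
    |cdf (Measure.map (fun ω => (Lt ω + Gt ω) / Real.sqrt (σL2 + σG2)) ℙ) y
        - cdf (gaussianReal 0 1) y|
      ≤ 0.56 * (∫ ω, |Lt ω| ^ 3) / (Real.sqrt (σL2 + σG2)) ^ 3 := by
  set S := √(σL2 + σG2) with hS
  have hS0 : 0 < S := Real.sqrt_pos.2 (by positivity)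
  have hS2 : S ^ 2 = σL2 + σG2 := Real.sq_sqrt (by positivity)
  have hv : (⟨σG2, hσG.le⟩ : NNReal) ≠ 0 := fun h => hσG.ne' (congrArg NNReal.toReal h)
  rw [cdf_map_add_div hv hS0 hLmeas hG hindep y]
  change |(∫ ω, Phi ((y - Lt ω / S) / (√σG2 / S))) - Phi y| ≤ _
  have ha : 0 < √σL2 / S := div_pos (Real.sqrt_pos.2 hσL) hS0
  have hs : 0 < √σG2 / S := div_pos (Real.sqrt_pos.2 hσG) hS0
  have has : (√σL2 / S) ^ 2 + (√σG2 / S) ^ 2 = 1 := by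
    rw [div_pow, div_pow, Real.sq_sqrt hσL.le, Real.sq_sqrt hσG.le, ← add_div, hS2,
      div_self (by positivity)]
  have hX : Measurable fun ω => Lt ω / S := hLmeas.div_const S
  have h1 : ∫ ω, Lt ω / S = 0 := by rw [integral_div, hLmean, zero_div]
  have h2 : ∫ ω, (Lt ω / S) ^ 2 = (√σL2 / S) ^ 2 := by
    simp only [div_pow]
    rw [integral_div, hLvar, Real.sq_sqrt hσL.le]
  have habs (ω : Ω) : |Lt ω / S| ^ 3 = |Lt ω| ^ 3 / S ^ 3 := by
    rw [abs_div, abs_of_pos hS0, div_pow]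
  have h3 : Integrable (fun ω => |Lt ω / S| ^ 3) ℙ := by
    simp only [habs]
    exact hL3.div_const _
  have hβ : ∫ ω, |Lt ω / S| ^ 3 = (∫ ω, |Lt ω| ^ 3) / S ^ 3 := by
    simp only [habs]
    rw [integral_div]
  have hupper := integral_Phi_le ha hs has hX h1 h2 h3 y
  have hlower := integral_Phi_le (P := (ℙ : Measure Ω)) ha hs has hX.neg
    (by simp [integral_neg, h1])
    (by simpa using h2) (by simpa using h3) (-y)
  have hneg : ∫ ω, Phi ((-y - (-fun ω => Lt ω / S) ω) / (√σG2 / S))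
      = 1 - ∫ ω, Phi ((y - Lt ω / S) / (√σG2 / S)) := by
    have (ω : Ω) : Phi ((-y - (-fun ω => Lt ω / S) ω) / (√σG2 / S))
        = 1 - Phi ((y - Lt ω / S) / (√σG2 / S)) := by
      rw [← Phi_neg, ← neg_div]
      congr 2
      simp only [Pi.neg_apply]
      ring
    simp only [this]
    rw [integral_sub (integrable_const 1) (integrable_Phi_comp hX y)]
    simp
  rw [hneg, Phi_neg] at hlower
  simp only [Pi.neg_apply, abs_neg] at hlower
  rw [hβ] at hupper hlower
  rw [mul_div_assoc, abs_le]
  constructor <;> linarith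
end

section
/- Intermediate Berry–Esseen bound for the decomposed Gaussian: Let L̃ be a real-valued random variable with E[L̃] = 0, variance σ_L² > 0, and E[|L̃|³] < ∞, and let G̃ ∼ N(0, σ_G²) with σ_G² > 0 be independent of L̃. Let Y = (L̃ + G̃) / √(σ_L² + σ_G²), with cumulative distribution function F_Y, and let Φ be the standard normal cumulative distribution function. Then for every integer M ≥ 2, sup_{y ∈ ℝ} |F_Y(y) − Φ(y)| ≤ 0.56 · ( E[|L̃|³] + (2√2/√π) · σ_G³ / √(M−1) ) / (√(σ_L² + σ_G²))³, where the second term in the numerator equals the sum of the third absolute moments of M−1 i.i.d. N(0, σ_G²/(M−1)) random variables whose sum has the law of G̃. -/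
open MeasureTheory ProbabilityTheory Real

local notation "γ" => gaussianReal 0 1
local notation "φ" => gaussianPDFReal 0 1
local notation "Φ" => cdf (gaussianReal 0 1)

lemma stdPDF_eq (x : ℝ) : φ x = (√(2 * π))⁻¹ * exp (-(1 / 2) * x ^ 2) := by
  rw [gaussianPDFReal]
  simp only [NNReal.coe_one, mul_one, sub_zero]
  ring_nf

lemma hasDerivAt_stdPDF (x : ℝ) : HasDerivAt φ (-x * φ x) x := by
  have h1 : HasDerivAt (fun x : ℝ => -(1 / 2) * x ^ 2) (-x) x := by
    refine ((hasDerivAt_pow 2 x).const_mul (-(1 / 2 : ℝ))).congr_deriv ?_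
    norm_num
    ring
  have h : HasDerivAt (fun x : ℝ => (√(2 * π))⁻¹ * exp (-(1 / 2) * x ^ 2)) (-x * φ x) x := by
    refine ((h1.exp).const_mul ((√(2 * π))⁻¹)).congr_deriv ?_
    rw [stdPDF_eq]
    ring
  exact h.congr_of_eventuallyEq (Filter.Eventually.of_forall stdPDF_eq)

lemma continuous_stdPDF : Continuous φ :=
  continuous_iff_continuousAt.2 fun x => (hasDerivAt_stdPDF x).continuousAt

lemma stdPDF_zero_le : (√(2 * π))⁻¹ ≤ 2 / 5 := by
  rw [inv_le_comm₀ (by positivity) (by norm_num)]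
  apply Real.le_sqrt_of_sq_le
  nlinarith [pi_gt_d2]

lemma le_stdPDF_zero : 0.398 ≤ (√(2 * π))⁻¹ := by
  rw [le_inv_comm₀ (by norm_num) (by positivity)]
  apply Real.sqrt_le_iff.2
  constructor
  · norm_num
  · nlinarith [pi_lt_d4]

lemma stdPDF_le (x : ℝ) : φ x ≤ 2 / 5 := by
  rw [stdPDF_eq]
  have : exp (-(1 / 2) * x ^ 2) ≤ 1 := exp_le_one_iff.2 (by nlinarith [sq_nonneg x])
  nlinarith [stdPDF_zero_le, exp_pos (-(1 / 2) * x ^ 2)]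

lemma abs_stdPDF_second_deriv_le (x : ℝ) : |(x ^ 2 - 1) * φ x| ≤ 2 / 5 := by
  have h0 : |x ^ 2 - 1| * exp (-(1 / 2) * x ^ 2) ≤ 1 := by
    have h1 : |x ^ 2 - 1| ≤ exp (x ^ 2 / 2) := by
      have := quadratic_le_exp_of_nonneg (x := x ^ 2 / 2) (by positivity)
      rw [abs_le]
      constructor <;> nlinarith [sq_nonneg (x ^ 2 - 2), sq_nonneg x]
    calc _ ≤ exp (x ^ 2 / 2) * exp (-(1 / 2) * x ^ 2) := by gcongr
      _ = 1 := by rw [← exp_add]; ring_nf; simp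
  rw [abs_mul, abs_of_nonneg (gaussianPDFReal_nonneg 0 1 x), stdPDF_eq]
  have h2 := stdPDF_zero_le
  have h3 : 0 ≤ |x ^ 2 - 1| * exp (-(1 / 2) * x ^ 2) := by positivity
  nlinarith

lemma stdCDF_sub (a b : ℝ) : Φ b - Φ a = ∫ x in a..b, φ x := by
  have key : ∀ c, Φ c = ∫ x in Set.Iic c, φ x := by
    intro c
    rw [cdf_eq_real, measureReal_def, gaussianReal_apply_eq_integral 0 one_ne_zero,
      ENNReal.toReal_ofReal]
    exact setIntegral_nonneg measurableSet_Iic fun x _ => gaussianPDFReal_nonneg 0 1 x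
  rw [key, key, intervalIntegral.integral_Iic_sub_Iic]
  · exact (integrable_gaussianPDFReal 0 1).integrableOn
  · exact (integrable_gaussianPDFReal 0 1).integrableOn

lemma hasDerivAt_stdCDF (x : ℝ) : HasDerivAt Φ (φ x) x := by
  have h := intervalIntegral.integral_hasDerivAt_right
    (continuous_stdPDF.intervalIntegrable 0 x)
    (continuous_stdPDF.stronglyMeasurableAtFilter _ _) continuous_stdPDF.continuousAt
  have := h.const_add (Φ 0)
  refine this.congr_of_eventuallyEq (Filter.Eventually.of_forall fun y => ?_)
  simp only [← stdCDF_sub]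
  ring

lemma continuous_stdCDF : Continuous Φ :=
  continuous_iff_continuousAt.2 fun x => (hasDerivAt_stdCDF x).continuousAt

lemma stdCDF_neg (x : ℝ) : Φ (-x) = 1 - Φ x := by
  have h : (γ).map (fun x => -x) = γ := by simpa using gaussianReal_map_neg (μ := 0) (v := 1)
  have := nullSingletonClass_gaussianReal (μ := 0) (v := 1) one_ne_zero
  rw [cdf_eq_real, cdf_eq_real, ← probReal_compl_eq_one_sub measurableSet_Iic, ← h,
    measureReal_def, measureReal_def, Measure.map_apply measurable_neg measurableSet_Iic, h]
  congr 1
  rw [Set.compl_Iic]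
  have : (fun x : ℝ => -x) ⁻¹' Set.Iic (-x) = Set.Ici x := by ext; simp
  rw [this]
  exact measure_congr Ioi_ae_eq_Ici.symm

lemma stdCDF_zero : Φ 0 = 1 / 2 := by
  have := stdCDF_neg 0
  rw [neg_zero] at this
  linarith

lemma stdCDF_sub_le {a b : ℝ} (hab : a ≤ b) : Φ b - Φ a ≤ 2 / 5 * (b - a) := by
  rw [stdCDF_sub]
  have := intervalIntegral.integral_mono_on hab (continuous_stdPDF.intervalIntegrable a b)
    (g := fun _ => (2 / 5 : ℝ)) (continuous_const.intervalIntegrable (μ := volume) a b)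
    (fun x _ => stdPDF_le x)
  rw [intervalIntegral.integral_const, smul_eq_mul] at this
  linarith

lemma integrable_pow_stdGaussian (k : ℕ) : Integrable (fun x : ℝ => x ^ k) γ := by
  have := (memLp_id_gaussianReal' (μ := 0) (v := 1) k (by simp)).integrable_norm_pow'
  refine this.congr' (by fun_prop) ?_
  exact Filter.Eventually.of_forall fun x => by simp

lemma integrable_pow_mul_stdPDF (k : ℕ) : Integrable (fun x : ℝ => x ^ k * φ x) := by
  have := (integrable_rpow_mul_exp_neg_mul_sq (b := 1 / 2) (by norm_num) (s := k)
    (by have := k.cast_nonneg (α := ℝ); linarith)).const_mul ((√(2 * π))⁻¹)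
  refine this.congr (Filter.Eventually.of_forall fun x => ?_)
  simp only [stdPDF_eq, rpow_natCast]
  ring

lemma integral_sq_stdGaussian : ∫ x, x ^ 2 ∂γ = 1 := by
  have h := variance_fun_id_gaussianReal (μ := 0) (v := 1)
  rw [variance_eq_integral (by fun_prop)] at h
  simpa using h

lemma integral_pow_four_stdGaussian : ∫ x, x ^ 4 ∂γ = 3 := by
  have h : ∀ x, HasDerivAt (fun x => -(x ^ 3 + 3 * x) * φ x) (x ^ 4 * φ x - 3 * φ x) x := by
    intro x
    refine ((((hasDerivAt_pow 3 x).add ((hasDerivAt_id x).const_mul 3)).neg).mul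
      (hasDerivAt_stdPDF x)).congr_deriv ?_
    simp
    ring
  have i0 := integrable_gaussianPDFReal 0 1
  have i1 := integrable_pow_mul_stdPDF 1
  have i3 := integrable_pow_mul_stdPDF 3
  have i4 := integrable_pow_mul_stdPDF 4
  have := integral_eq_zero_of_hasDerivAt_of_integrable h (i4.sub (i0.const_mul 3))
    ((i3.add (i1.const_mul 3)).neg.congr (Filter.Eventually.of_forall fun x => by simp; ring))
  rw [integral_sub i4 (i0.const_mul 3), integral_const_mul,
    integral_gaussianPDFReal_eq_one 0 one_ne_zero] at this
  rw [integral_gaussianReal_eq_integral_smul one_ne_zero]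
  simp only [smul_eq_mul, mul_comm (φ _)]
  linarith

lemma integral_abs_cube_stdGaussian_le : ∫ x, |x| ^ 3 ∂γ ≤ 7 / 4 := by
  have i2 := integrable_pow_stdGaussian 2
  have i4 := integrable_pow_stdGaussian 4
  have : ∫ x, |x| ^ 3 ∂γ ≤ ∫ x, (x ^ 2 + 1 / 4 * x ^ 4) ∂γ := by
    refine integral_mono_of_nonneg (Filter.Eventually.of_forall fun x => by positivity)
      (i2.add (i4.const_mul _)) (Filter.Eventually.of_forall fun x => ?_)
    simp only
    have h2 : x ^ 2 = |x| ^ 2 := (sq_abs x).symm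
    have h4 : x ^ 4 = |x| ^ 4 := by rw [← abs_pow, abs_of_nonneg (by positivity)]
    rw [h2, h4]
    nlinarith [sq_nonneg (|x| * (|x| - 2))]
  rw [integral_add i2 (i4.const_mul _), integral_const_mul, integral_sq_stdGaussian,
    integral_pow_four_stdGaussian] at this
  linarith

lemma integral_Ioi_id_stdGaussian (z : ℝ) : ∫ x in Set.Ioi z, x ∂γ = φ z := by
  have h : ∀ x ∈ Set.Ici z, HasDerivAt (fun x => -φ x) (x * φ x) x := by
    intro x _
    refine (hasDerivAt_stdPDF x).neg.congr_deriv ?_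
    ring
  have i1 : Integrable (fun x : ℝ => x * φ x) := by simpa using integrable_pow_mul_stdPDF 1
  have h2 := integral_Ioi_of_hasDerivAt_of_tendsto' h i1.integrableOn (m := 0) (by
    have := tendsto_zero_of_hasDerivAt_of_integrableOn_Ioi (a := 0) (f := φ) (f' := fun x => -x * φ x)
      (fun x _ => hasDerivAt_stdPDF x) (by simpa using i1.neg.integrableOn)
      (integrable_gaussianPDFReal 0 1).integrableOn
    simpa using this.neg)
  rw [gaussianReal_of_var_ne_zero _ one_ne_zero,
    setIntegral_withDensity_eq_setIntegral_toReal_smul (measurable_gaussianPDF 0 1)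
      (Filter.Eventually.of_forall fun x => gaussianPDF_lt_top) _ measurableSet_Ioi]
  simp only [toReal_gaussianPDF, smul_eq_mul, mul_comm (φ _)]
  linarith

lemma integral_Iic_id_stdGaussian (z : ℝ) : ∫ x in Set.Iic z, x ∂γ = -φ z := by
  have h := integral_add_compl (μ := γ) (f := fun x => x) (measurableSet_Iic (a := z))
    (by simpa using integrable_pow_stdGaussian 1)
  rw [Set.compl_Iic, integral_Ioi_id_stdGaussian, integral_id_gaussianReal] at h
  linarith

/-- The disc of radius `z` has smaller planar Gaussian measure than the square `[-z, z]²`. -/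
lemma one_sub_exp_le_sq_stdCDF_of_nonneg {z : ℝ} (hz : 0 ≤ z) :
    1 - exp (-(1 / 2) * z ^ 2) ≤ (2 * Φ z - 1) ^ 2 := by
  set D : ℝ → ℝ := fun z => (2 * Φ z - 1) ^ 2 - 1 + √(2 * π) * φ z with hD
  set k : ℝ → ℝ := fun z => 4 * (2 * Φ z - 1) - √(2 * π) * z with hk
  have hs : 0 < √(2 * π) := by positivity
  have hexp : ∀ z, √(2 * π) * φ z = exp (-(1 / 2) * z ^ 2) := by
    intro z
    rw [stdPDF_eq]
    field_simp
  have hDd : ∀ z, HasDerivAt D (φ z * k z) z := by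
    intro z
    refine ((((((hasDerivAt_stdCDF z).const_mul 2).sub_const 1).pow 2).sub_const 1).add
      ((hasDerivAt_stdPDF z).const_mul (√(2 * π)))).congr_deriv ?_
    simp [hk]
    ring
  have hkd : ∀ z, HasDerivAt k (8 * φ z - √(2 * π)) z := by
    intro z
    refine (((((hasDerivAt_stdCDF z).const_mul 2).sub_const 1).const_mul 4).sub
      ((hasDerivAt_id z).const_mul (√(2 * π)))).congr_deriv ?_
    ring
  have hkcont : Continuous k := continuous_iff_continuousAt.2 fun x => (hkd x).continuousAt
  have hDcont : Continuous D := continuous_iff_continuousAt.2 fun x => (hDd x).continuousAt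
  have hconc : ConcaveOn ℝ (Set.Ici 0) k := by
    refine AntitoneOn.concaveOn_of_deriv (convex_Ici 0) hkcont.continuousOn
      (fun x _ => (hkd x).differentiableAt.differentiableWithinAt) ?_
    intro a ha b hb hab
    simp only [interior_Ici, Set.mem_Ioi] at ha hb
    rw [(hkd a).deriv, (hkd b).deriv]
    have : φ b ≤ φ a := by
      rw [stdPDF_eq, stdPDF_eq]
      gcongr ?_ * exp ?_
      nlinarith
    linarith
  have hk0 : k 0 = 0 := by simp [hk, stdCDF_zero]
  suffices 0 ≤ D z by
    have h1 := hexp z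
    simp only [hD] at this
    linarith
  rcases le_or_gt 0 (k z) with hkz | hkz
  · have hmono : MonotoneOn D (Set.Icc 0 z) := by
      refine monotoneOn_of_deriv_nonneg (convex_Icc 0 z) hDcont.continuousOn
        (fun x _ => (hDd x).differentiableAt.differentiableWithinAt) fun x hx => ?_
      rw [interior_Icc] at hx
      rw [(hDd x).deriv]
      refine mul_nonneg (gaussianPDFReal_nonneg 0 1 x) ?_
      have := hconc.min_le_of_mem_Icc (x := 0) (y := z) (z := x) (by simp) hz ⟨hx.1.le, hx.2.le⟩
      rw [hk0, min_eq_left hkz] at this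
      exact this
    have := hmono (Set.left_mem_Icc.2 hz) (Set.right_mem_Icc.2 hz) hz
    have h0 : D 0 = 0 := by
      simp only [hD, hexp]
      simp [stdCDF_zero]
    linarith
  · have hanti : AntitoneOn D (Set.Ici z) := by
      refine antitoneOn_of_deriv_nonpos (convex_Ici z) hDcont.continuousOn
        (fun x _ => (hDd x).differentiableAt.differentiableWithinAt) fun x hx => ?_
      simp only [interior_Ici, Set.mem_Ioi] at hx
      rw [(hDd x).deriv]
      refine mul_nonpos_of_nonneg_of_nonpos (gaussianPDFReal_nonneg 0 1 x) ?_
      by_contra! hc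
      have := hconc.min_le_of_mem_Icc (x := 0) (y := x) (z := z) (by simp) (hz.trans hx.le)
        ⟨hz, hx.le⟩
      rw [hk0, min_eq_left hc.le] at this
      linarith
    have hlim : Filter.Tendsto D Filter.atTop (nhds 0) := by
      have h1 := tendsto_cdf_atTop γ
      have h2 := tendsto_zero_of_hasDerivAt_of_integrableOn_Ioi (a := 0) (f := φ)
        (f' := fun x => -x * φ x) (fun x _ => hasDerivAt_stdPDF x)
        (by simpa using (integrable_pow_mul_stdPDF 1).neg.integrableOn)
        (integrable_gaussianPDFReal 0 1).integrableOn
      have := ((((h1.const_mul 2).sub_const 1).pow 2).sub_const 1).add (h2.const_mul (√(2 * π)))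
      convert this using 2
      norm_num
    refine le_of_tendsto hlim ?_
    filter_upwards [Filter.eventually_ge_atTop z] with x hx
    exact hanti Set.self_mem_Ici hx hx

lemma stdCDF_mul_one_sub_le (z : ℝ) : 1.592 * (Φ z * (1 - Φ z)) ≤ φ z := by
  have key : 1 - exp (-(1 / 2) * z ^ 2) ≤ (2 * Φ z - 1) ^ 2 := by
    rcases le_total 0 z with hz | hz
    · exact one_sub_exp_le_sq_stdCDF_of_nonneg hz
    · have := one_sub_exp_le_sq_stdCDF_of_nonneg (neg_nonneg.2 hz)
      rw [stdCDF_neg, neg_sq] at this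
      linarith
  rw [stdPDF_eq]
  have := le_stdPDF_zero
  have := exp_pos (-(1 / 2) * z ^ 2)
  nlinarith

lemma nonneg_of_hasDerivAt_nonneg_s2 {r r' : ℝ → ℝ} (h0 : r 0 = 0)
    (h : ∀ x, HasDerivAt r (r' x) x) (h' : ∀ x, 0 ≤ x → 0 ≤ r' x) : ∀ x, 0 ≤ x → 0 ≤ r x := by
  have hmono : MonotoneOn r (Set.Ici 0) := by
    refine monotoneOn_of_deriv_nonneg (convex_Ici 0)
      (fun x _ => (h x).continuousAt.continuousWithinAt)
      (fun x _ => (h x).differentiableAt.differentiableWithinAt) fun x hx => ?_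
    rw [(h x).deriv]
    rw [interior_Ici] at hx
    exact h' x (le_of_lt hx)
  intro x hx
  have := hmono Set.self_mem_Ici hx hx
  linarith

lemma le_taylor_of_third_deriv_le {f f₁ f₂ f₃ : ℝ → ℝ} {K : ℝ}
    (h₁ : ∀ x, HasDerivAt f (f₁ x) x) (h₂ : ∀ x, HasDerivAt f₁ (f₂ x) x)
    (h₃ : ∀ x, HasDerivAt f₂ (f₃ x) x) (hK : ∀ x, f₃ x ≤ K) {u : ℝ} (hu : 0 ≤ u) :
    f u ≤ f 0 + u * f₁ 0 + u ^ 2 / 2 * f₂ 0 + K * u ^ 3 / 6 := by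
  have d2 : ∀ x, 0 ≤ x → 0 ≤ f₂ 0 + K * x - f₂ x := by
    refine nonneg_of_hasDerivAt_nonneg_s2 (r' := fun x => K - f₃ x) (by simp) (fun x => ?_)
      fun x _ => sub_nonneg.2 (hK x)
    refine ((((hasDerivAt_id x).const_mul K).const_add (f₂ 0)).sub (h₃ x)).congr_deriv ?_
    simp
  have d1 : ∀ x, 0 ≤ x → 0 ≤ f₁ 0 + f₂ 0 * x + K / 2 * x ^ 2 - f₁ x := by
    refine nonneg_of_hasDerivAt_nonneg_s2 (by simp) (fun x => ?_) d2
    refine (((((hasDerivAt_id x).const_mul (f₂ 0)).const_add (f₁ 0)).add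
      ((hasDerivAt_pow 2 x).const_mul (K / 2))).sub (h₂ x)).congr_deriv ?_
    simp
    ring
  have d0 : ∀ x, 0 ≤ x → 0 ≤ f 0 + f₁ 0 * x + f₂ 0 / 2 * x ^ 2 + K / 6 * x ^ 3 - f x := by
    refine nonneg_of_hasDerivAt_nonneg_s2 (by simp) (fun x => ?_) d1
    refine ((((((hasDerivAt_id x).const_mul (f₁ 0)).const_add (f 0)).add
      ((hasDerivAt_pow 2 x).const_mul (f₂ 0 / 2))).add
      ((hasDerivAt_pow 3 x).const_mul (K / 6))).sub (h₁ x)).congr_deriv ?_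
    simp
    ring
  have := d0 u hu
  linarith

lemma abs_stdCDF_sub_taylor_le (a u : ℝ) :
    |Φ (a + u) - (Φ a + u * φ a - u ^ 2 / 2 * (a * φ a))| ≤ |u| ^ 3 / 15 := by
  have key : ∀ ε δ : ℝ, |ε| = 1 → |δ| = 1 → ∀ u, 0 ≤ u →
      ε * Φ (a + δ * u) ≤ ε * Φ a + u * (ε * δ * φ a)
        + u ^ 2 / 2 * (ε * (-(a * φ a))) + (2 / 5) * u ^ 3 / 6 := by
    intro ε δ hε hδ u hu
    have hδ2 : δ ^ 2 = 1 := by rw [← sq_abs, hδ, one_pow]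
    have hlin : ∀ x, HasDerivAt (fun x => a + δ * x) δ x := fun x => by
      simpa using ((hasDerivAt_id x).const_mul δ).const_add a
    have := le_taylor_of_third_deriv_le (f := fun x => ε * Φ (a + δ * x))
      (f₁ := fun x => ε * δ * φ (a + δ * x))
      (f₂ := fun x => ε * (-((a + δ * x) * φ (a + δ * x))))
      (f₃ := fun x => ε * δ * (((a + δ * x) ^ 2 - 1) * φ (a + δ * x))) (K := 2 / 5)
      (fun x => by
        refine (((hasDerivAt_stdCDF _).comp x (hlin x)).const_mul ε).congr_deriv ?_
        ring)
      (fun x => by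
        refine (((hasDerivAt_stdPDF _).comp x (hlin x)).const_mul (ε * δ)).congr_deriv ?_
        linear_combination (-ε * (a + δ * x) * φ (a + δ * x)) * hδ2)
      (fun x => by
        refine (((hlin x).mul ((hasDerivAt_stdPDF _).comp x (hlin x))).neg.const_mul
          ε).congr_deriv ?_
        simp only [Function.comp]
        ring)
      (fun x => by
        refine (le_abs_self _).trans ?_
        rw [abs_mul, abs_mul, hε, hδ, one_mul, one_mul]
        exact abs_stdPDF_second_deriv_le _)
      hu
    simpa using this
  have e1 : |(1 : ℝ)| = 1 := abs_one
  have e2 : |(-1 : ℝ)| = 1 := by simp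
  rw [abs_le]
  rcases le_total 0 u with hu | hu
  · have h1 := key 1 1 e1 e1 u hu
    have h2 := key (-1) 1 e2 e1 u hu
    rw [abs_of_nonneg hu]
    rw [one_mul (u : ℝ)] at h1 h2
    constructor <;> linarith
  · have h1 := key 1 (-1) e1 e2 (-u) (by linarith)
    have h2 := key (-1) (-1) e2 e2 (-u) (by linarith)
    rw [abs_of_nonpos hu]
    rw [show (-1 : ℝ) * -u = u by ring] at h1 h2
    constructor <;> nlinarith

lemma integrable_stdCDF_comp (μ : Measure ℝ) [IsFiniteMeasure μ] {f : ℝ → ℝ} (hf : Measurable f) :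
    Integrable (fun x => Φ (f x)) μ := by
  refine Integrable.of_bound ((monotone_cdf γ).measurable.comp hf).aestronglyMeasurable 1 ?_
  refine Filter.Eventually.of_forall fun x => ?_
  rw [Real.norm_eq_abs, abs_of_nonneg (cdf_nonneg _ _)]
  exact cdf_le_one _ _

lemma gaussianReal_real_Iic {t : ℝ} (ht : 0 < t) {w : NNReal} (hw : (w : ℝ) = t ^ 2) (c : ℝ) :
    (gaussianReal 0 w).real (Set.Iic c) = Φ (c / t) := by
  have hw' : w = NNReal.mk (t ^ 2) (sq_nonneg t) := NNReal.eq hw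
  have h := gaussianReal_map_const_mul (μ := 0) (v := 1) t
  rw [mul_zero, mul_one, ← hw'] at h
  rw [cdf_eq_real, measureReal_def, measureReal_def, ← h,
    Measure.map_apply (by fun_prop) measurableSet_Iic]
  congr 2
  ext x
  simp [le_div_iff₀ ht, mul_comm]

lemma cdf_conv_gaussianReal (μ : Measure ℝ) [IsProbabilityMeasure μ] {t : ℝ} (ht : 0 < t)
    {w : NNReal} (hw : (w : ℝ) = t ^ 2) (y : ℝ) :
    cdf (μ.conv (gaussianReal 0 w)) y = ∫ x, Φ ((y - x) / t) ∂μ := by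
  have hmeas : MeasurableSet ((fun p : ℝ × ℝ => p.1 + p.2) ⁻¹' Set.Iic y) :=
    (by fun_prop : Measurable fun p : ℝ × ℝ => p.1 + p.2) measurableSet_Iic
  rw [cdf_eq_real, Measure.conv, measureReal_def, Measure.map_apply (by fun_prop) measurableSet_Iic,
    Measure.prod_apply hmeas, ← integral_toReal]
  · refine integral_congr_ae (Filter.Eventually.of_forall fun x => ?_)
    simp only
    rw [← gaussianReal_real_Iic ht hw, measureReal_def]
    congr 2
    ext z
    simp [le_sub_iff_add_le, add_comm]
  · exact (measurable_measure_prodMk_left hmeas).aemeasurable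
  · exact Filter.Eventually.of_forall fun x => measure_lt_top _ _

lemma integral_stdCDF_stdGaussian {s t : ℝ} (ht : 0 < t) (hst : s ^ 2 + t ^ 2 = 1) (y : ℝ) :
    ∫ n, Φ ((y - s * n) / t) ∂γ = Φ y := by
  have h := gaussianReal_map_const_mul (μ := 0) (v := 1) s
  rw [mul_zero, mul_one] at h
  have hp : IsProbabilityMeasure ((γ).map (s * ·)) :=
    Measure.isProbabilityMeasure_map (by fun_prop)
  have h1 := cdf_conv_gaussianReal ((γ).map (s * ·)) ht
    (w := NNReal.mk (t ^ 2) (sq_nonneg t)) rfl y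
  rw [integral_map (by fun_prop) (integrable_stdCDF_comp _ (by fun_prop)).1] at h1
  rw [← h1, h, gaussianReal_conv_gaussianReal, add_zero]
  congr 3
  exact NNReal.eq hst

section Quadratic

variable {ν : Measure ℝ} [IsFiniteMeasure ν]

lemma integrable_quadratic (i1 : Integrable (fun x => x) ν) (i2 : Integrable (fun x => x ^ 2) ν)
    (a b c : ℝ) : Integrable (fun x => a + b * x + c * x ^ 2) ν :=
  ((integrable_const a).add (i1.const_mul b)).add (i2.const_mul c)

lemma integral_quadratic (i1 : Integrable (fun x => x) ν) (i2 : Integrable (fun x => x ^ 2) ν)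
    (a b c : ℝ) : ∫ x, (a + b * x + c * x ^ 2) ∂ν
      = a * ν.real Set.univ + b * ∫ x, x ∂ν + c * ∫ x, x ^ 2 ∂ν := by
  have h1 : Integrable (fun x => a + b * x) ν := (integrable_const a).add (i1.const_mul b)
  rw [integral_add h1 (i2.const_mul c), integral_add (integrable_const a) (i1.const_mul b),
    integral_const_mul, integral_const_mul, integral_const, smul_eq_mul, mul_comm a]

lemma integrable_id_stdGaussian : Integrable (fun x : ℝ => x) γ := by
  simpa using integrable_pow_stdGaussian 1

lemma integral_quadratic_stdGaussian (a b c : ℝ) :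
    ∫ x, (a + b * x + c * x ^ 2) ∂γ = a + c := by
  rw [integral_quadratic integrable_id_stdGaussian (integrable_pow_stdGaussian 2),
    integral_id_gaussianReal, integral_sq_stdGaussian]
  simp

end Quadratic

section Moments

variable {μ : Measure ℝ} [IsProbabilityMeasure μ]

lemma integrable_sq_of_abs_cube (h3 : Integrable (fun x => |x| ^ 3) μ) :
    Integrable (fun x => x ^ 2) μ := by
  refine ((integrable_const 1).add h3).mono' (by fun_prop) (Filter.Eventually.of_forall fun x => ?_)
  have h0 := abs_nonneg x
  simp only [norm_pow, Real.norm_eq_abs, Pi.add_apply]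
  nlinarith [mul_nonneg h0 (sq_nonneg (|x| - 1)), sq_nonneg (|x| - 1)]

lemma integrable_id_of_abs_cube (h3 : Integrable (fun x => |x| ^ 3) μ) :
    Integrable (fun x => x) μ := by
  refine ((integrable_const 1).add (integrable_sq_of_abs_cube h3)).mono' (by fun_prop)
    (Filter.Eventually.of_forall fun x => ?_)
  simp only [Real.norm_eq_abs, Pi.add_apply, ← sq_abs x]
  nlinarith [sq_nonneg (|x| - 1)]

lemma cube_le_integral_abs_cube_s2 (h3 : Integrable (fun x => |x| ^ 3) μ) {s : ℝ} (hs : 0 < s)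
    (hv : ∫ x, x ^ 2 ∂μ = s ^ 2) : s ^ 3 ≤ ∫ x, |x| ^ 3 ∂μ := by
  have i2 := integrable_sq_of_abs_cube h3
  have : ∫ x, (3 / 2 * s * x ^ 2 - s ^ 3 / 2) ∂μ ≤ ∫ x, |x| ^ 3 ∂μ := by
    refine integral_mono ((i2.const_mul _).sub (integrable_const _)) h3 fun x => ?_
    have h0 := abs_nonneg x
    simp only [← sq_abs x]
    nlinarith [mul_nonneg h0 (sq_nonneg (|x| - s)), mul_nonneg hs.le (sq_nonneg (|x| - s))]
  rw [integral_sub (i2.const_mul _) (integrable_const _), integral_const_mul, hv] at this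
  simp at this
  nlinarith

lemma pow_four_le_mul_integral_pos (h3 : Integrable (fun x => |x| ^ 3) μ) {s : ℝ} (hs : 0 < s)
    (hm : ∫ x, x ∂μ = 0) (hv : ∫ x, x ^ 2 ∂μ = s ^ 2) :
    s ^ 4 ≤ 2 * (∫ x, |x| ^ 3 ∂μ) * ∫ x in Set.Ioi 0, x ∂μ := by
  have i1 := integrable_id_of_abs_cube h3
  have i2 := integrable_sq_of_abs_cube h3
  have hβ : 0 < ∫ x, |x| ^ 3 ∂μ :=
    (pow_pos hs 3).trans_le (cube_le_integral_abs_cube_s2 h3 hs hv)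
  set β := ∫ x, |x| ^ 3 ∂μ with hβdef
  have hsplit := integral_add_compl (μ := μ) (measurableSet_Ioi (a := (0 : ℝ))) i1
  have habs := integral_add_compl (μ := μ) (measurableSet_Ioi (a := (0 : ℝ))) i1.abs
  rw [setIntegral_congr_fun (g := fun x => x) measurableSet_Ioi
      (fun x hx => abs_of_pos hx),
    setIntegral_congr_fun (g := fun x => -x) measurableSet_Ioi.compl
      (fun x hx => abs_of_nonpos (by simpa using hx)), integral_neg] at habs
  have hle : ∫ x, 2 * x ^ 2 ∂μ ≤ ∫ x, (β / s ^ 2 * |x| + s ^ 2 / β * |x| ^ 3) ∂μ := by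
    refine integral_mono (i2.const_mul _) ((i1.abs.const_mul _).add (h3.const_mul _)) fun x => ?_
    simp only [← sq_abs x]
    have e : β / s ^ 2 * |x| + s ^ 2 / β * |x| ^ 3 - 2 * |x| ^ 2
        = |x| * (s ^ 2 * |x| - β) ^ 2 / (s ^ 2 * β) := by
      field_simp
      ring
    have : 0 ≤ |x| * (s ^ 2 * |x| - β) ^ 2 / (s ^ 2 * β) := by positivity
    linarith
  rw [integral_add (i1.abs.const_mul _) (h3.const_mul _), integral_const_mul, integral_const_mul,
    integral_const_mul, hv, ← hβdef, div_mul_cancel₀ _ hβ.ne', div_mul_eq_mul_div] at hle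
  have h' : s ^ 2 * s ^ 2 ≤ β * ∫ x, |x| ∂μ := by
    rw [← le_div_iff₀ (by positivity)]
    linarith
  nlinarith

end Moments

section SmallVariance

lemma integral_stdCDF_le_of_sq_le_half {μ : Measure ℝ} [IsProbabilityMeasure μ]
    (h3 : Integrable (fun x => |x| ^ 3) μ) {s t : ℝ} (hs : 0 < s) (ht : 0 < t)
    (hst : s ^ 2 + t ^ 2 = 1) (hm : ∫ x, x ∂μ = 0) (hv : ∫ x, x ^ 2 ∂μ = s ^ 2)
    (hs2 : s ^ 2 ≤ 1 / 2) (y : ℝ) :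
    ∫ x, Φ ((y - x) / t) ∂μ ≤ Φ y + 0.56 * ∫ x, |x| ^ 3 ∂μ := by
  have hβ := cube_le_integral_abs_cube_s2 h3 hs hv
  set β := ∫ x, |x| ^ 3 ∂μ with hβdef
  have i1 := integrable_id_of_abs_cube h3
  have i2 := integrable_sq_of_abs_cube h3
  set a := y / t with ha
  set c₁ := φ a / t with hc₁
  set c₂ := a * φ a / (2 * t ^ 2) with hc₂
  have taylor : ∀ x, |Φ ((y - x) / t) - (Φ a - c₁ * x - c₂ * x ^ 2)|
      ≤ 1 / (15 * t ^ 3) * |x| ^ 3 := by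
    intro x
    have := abs_stdCDF_sub_taylor_le a (-x / t)
    have e1 : a + -x / t = (y - x) / t := by rw [ha]; ring
    have e2 : |-x / t| ^ 3 / 15 = 1 / (15 * t ^ 3) * |x| ^ 3 := by
      rw [abs_div, abs_neg, abs_of_pos ht]
      field_simp
    rw [e1, e2] at this
    convert this using 3
    rw [hc₁, hc₂]
    field_simp
    ring
  have up : ∫ x, Φ ((y - x) / t) ∂μ ≤ Φ a - c₂ * s ^ 2 + 1 / (15 * t ^ 3) * β := by
    have : ∫ x, Φ ((y - x) / t) ∂μ
        ≤ ∫ x, ((Φ a + -c₁ * x + -c₂ * x ^ 2) + 1 / (15 * t ^ 3) * |x| ^ 3) ∂μ := by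
      refine integral_mono (integrable_stdCDF_comp _ (by fun_prop))
        ((integrable_quadratic i1 i2 _ _ _).add (h3.const_mul _)) fun x => ?_
      have := (abs_le.1 (taylor x)).2
      simp only
      linarith
    rw [integral_add (integrable_quadratic i1 i2 _ _ _) (h3.const_mul _), integral_const_mul,
      integral_quadratic i1 i2, hm, hv, probReal_univ] at this
    linarith
  have low : Φ a - c₂ * s ^ 2 - 1 / (15 * t ^ 3) * (s ^ 3 * (7 / 4)) ≤ Φ y := by
    have j := integrable_quadratic integrable_id_stdGaussian (integrable_pow_stdGaussian 2)
    have j3 : Integrable (fun x : ℝ => |x| ^ 3) γ := by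
      simpa [abs_pow] using (integrable_pow_stdGaussian 3).abs
    have : ∫ x, ((Φ a + -(c₁ * s) * x + -(c₂ * s ^ 2) * x ^ 2)
          - 1 / (15 * t ^ 3) * s ^ 3 * |x| ^ 3) ∂γ
        ≤ ∫ x, Φ ((y - s * x) / t) ∂γ := by
      refine integral_mono ((j _ _ _).sub (j3.const_mul _))
        (integrable_stdCDF_comp _ (by fun_prop)) fun x => ?_
      have := (abs_le.1 (taylor (s * x))).1
      rw [abs_mul, abs_of_pos hs] at this
      simp only
      nlinarith
    rw [integral_stdCDF_stdGaussian ht hst, integral_sub (j _ _ _) (j3.const_mul _),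
      integral_const_mul, integral_quadratic_stdGaussian] at this
    have h7 := integral_abs_cube_stdGaussian_le
    have : 1 / (15 * t ^ 3) * s ^ 3 * ∫ x, |x| ^ 3 ∂γ ≤ 1 / (15 * t ^ 3) * s ^ 3 * (7 / 4) := by
      gcongr
    linarith
  have ht3 : 0.35 ≤ t ^ 3 := by
    have : 0.707 ≤ t := by nlinarith
    calc (0.35 : ℝ) ≤ 0.707 ^ 3 := by norm_num
      _ ≤ t ^ 3 := by gcongr
  have hk : 1 / (15 * t ^ 3) ≤ 0.191 := by
    rw [div_le_iff₀ (by positivity)]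
    linarith
  have hs3 : 0 < s ^ 3 := by positivity
  nlinarith

end SmallVariance

section LargeVariance

variable {μ : Measure ℝ} [IsProbabilityMeasure μ]

/-- Chebyshev's inequality for `x + t Z`, centred at `c`. -/
lemma stdCDF_le_sq {t : ℝ} (ht : 0 < t) {y c : ℝ} (hyc : y < c) (x : ℝ) :
    Φ ((y - x) / t) ≤ ((x - c) ^ 2 + t ^ 2) / (c - y) ^ 2 := by
  have hcy : 0 < c - y := sub_pos.2 hyc
  have h : ∫ n, (Set.Iic ((y - x) / t)).indicator 1 n ∂γ
      ≤ ∫ n, ((x - c) ^ 2 + 2 * t * (x - c) * n + t ^ 2 * n ^ 2) / (c - y) ^ 2 ∂γ := by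
    refine integral_mono ((integrable_const 1).indicator measurableSet_Iic)
      ((integrable_quadratic integrable_id_stdGaussian (integrable_pow_stdGaussian 2)
        _ _ _).div_const _) fun n => ?_
    simp only
    rw [show (x - c) ^ 2 + 2 * t * (x - c) * n + t ^ 2 * n ^ 2 = (x + t * n - c) ^ 2 by ring]
    by_cases hn : n ∈ Set.Iic ((y - x) / t)
    · rw [Set.indicator_of_mem hn, Pi.one_apply, one_le_div (by positivity)]
      rw [Set.mem_Iic, le_div_iff₀ ht] at hn
      nlinarith
    · rw [Set.indicator_of_notMem hn]
      positivity
  rwa [integral_indicator_one measurableSet_Iic, ← cdf_eq_real, integral_div,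
    integral_quadratic_stdGaussian] at h

lemma le_stdCDF_of_second_moment {t : ℝ} (ht : 0 < t) {a : ℝ} (ha : 0 ≤ a) (x : ℝ) :
    2 * a * (Set.Ioi 0).indicator (fun x => x) x - a ^ 2 * (x ^ 2 + t ^ 2) ≤ 1 - Φ (-x / t) := by
  set e : ℝ := (Set.Ioi 0).indicator (fun _ => 1) x with he
  have he' : (Set.Ioi 0).indicator (fun x => x) x = e * x := by
    by_cases hx : x ∈ Set.Ioi 0 <;> simp [he, hx]
  have he2 : 0 ≤ e ∧ e ≤ 1 := by
    by_cases hx : x ∈ Set.Ioi 0 <;> simp [he, hx]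
  have h : ∫ n, (2 * a * e * x - a ^ 2 * x ^ 2 + (2 * a * e * t - 2 * a ^ 2 * x * t) * n
        + -(a ^ 2 * t ^ 2) * n ^ 2) ∂γ
      ≤ ∫ n, (Set.Iic (-x / t))ᶜ.indicator 1 n ∂γ := by
    refine integral_mono
      (integrable_quadratic integrable_id_stdGaussian (integrable_pow_stdGaussian 2) _ _ _)
      ((integrable_const 1).indicator measurableSet_Iic.compl) fun n => ?_
    simp only
    rw [show 2 * a * e * x - a ^ 2 * x ^ 2 + (2 * a * e * t - 2 * a ^ 2 * x * t) * n
      + -(a ^ 2 * t ^ 2) * n ^ 2 = 2 * e * (a * (x + t * n)) - (a * (x + t * n)) ^ 2 by ring]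
    by_cases hn : n ∈ (Set.Iic (-x / t))ᶜ
    · rw [Set.indicator_of_mem hn, Pi.one_apply]
      nlinarith [sq_nonneg (a * (x + t * n) - e)]
    · rw [Set.indicator_of_notMem hn]
      rw [Set.mem_compl_iff, not_not, Set.mem_Iic, le_div_iff₀ ht] at hn
      have : a * (x + t * n) ≤ 0 := mul_nonpos_of_nonneg_of_nonpos ha (by linarith)
      nlinarith [sq_nonneg (a * (x + t * n))]
  rw [integral_indicator_one measurableSet_Iic.compl, probReal_compl_eq_one_sub measurableSet_Iic,
    ← cdf_eq_real, integral_quadratic_stdGaussian] at h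
  rw [he']
  linarith

lemma integral_stdCDF_le_cantelli (h3 : Integrable (fun x => |x| ^ 3) μ) {s t : ℝ} (ht : 0 < t)
    (hst : s ^ 2 + t ^ 2 = 1) (hm : ∫ x, x ∂μ = 0) (hv : ∫ x, x ^ 2 ∂μ = s ^ 2)
    {y : ℝ} (hy : y < 0) : ∫ x, Φ ((y - x) / t) ∂μ ≤ 1 / (1 + y ^ 2) := by
  have i1 := integrable_id_of_abs_cube h3
  have i2 := integrable_sq_of_abs_cube h3
  have hc : y < -1 / y := hy.trans (div_pos_of_neg_of_neg (by norm_num) hy)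
  set c := -1 / y with hcdef
  have h : ∫ x, Φ ((y - x) / t) ∂μ
      ≤ ∫ x, (c ^ 2 + t ^ 2 + -(2 * c) * x + 1 * x ^ 2) / (c - y) ^ 2 ∂μ := by
    refine integral_mono (integrable_stdCDF_comp _ (by fun_prop))
      ((integrable_quadratic i1 i2 _ _ _).div_const _) fun x => ?_
    refine (stdCDF_le_sq ht hc x).trans_eq ?_
    ring
  rw [integral_div, integral_quadratic i1 i2, hm, hv, probReal_univ] at h
  refine h.trans_eq ?_
  rw [show (c ^ 2 + t ^ 2) * 1 + -(2 * c) * 0 + 1 * s ^ 2 = 1 + c ^ 2 by linarith, hcdef]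
  have hy0 := hy.ne
  have h1 : 0 < 1 + y ^ 2 := by positivity
  have h2 : -1 / y - y = -(1 + y ^ 2) / y := by field_simp; ring
  rw [h2]
  field_simp
  ring

lemma sq_integral_pos_le (h3 : Integrable (fun x => |x| ^ 3) μ) {s t : ℝ} (ht : 0 < t)
    (hst : s ^ 2 + t ^ 2 = 1) (hv : ∫ x, x ^ 2 ∂μ = s ^ 2) :
    (∫ x in Set.Ioi 0, x ∂μ) ^ 2 ≤ 1 - ∫ x, Φ (-x / t) ∂μ := by
  have i1 := integrable_id_of_abs_cube h3
  have i2 := integrable_sq_of_abs_cube h3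
  set m := ∫ x in Set.Ioi 0, x ∂μ with hmdef
  have hm0 : 0 ≤ m := setIntegral_nonneg measurableSet_Ioi fun x hx => le_of_lt hx
  have ii := i1.indicator (measurableSet_Ioi (a := (0 : ℝ)))
  have iq : Integrable (fun x => m ^ 2 * (x ^ 2 + t ^ 2)) μ :=
    (i2.add (integrable_const (t ^ 2))).const_mul (m ^ 2)
  have h := integral_mono ((ii.const_mul (2 * m)).sub iq)
    ((integrable_const 1).sub (integrable_stdCDF_comp μ (f := fun x => -x / t) (by fun_prop)))
    (fun x => le_stdCDF_of_second_moment ht hm0 x)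
  simp only [Pi.sub_apply] at h
  rw [integral_sub (ii.const_mul (2 * m)) iq, integral_const_mul, integral_const_mul,
    integral_indicator measurableSet_Ioi, integral_add i2 (integrable_const _), hv,
    integral_sub (integrable_const _) (integrable_stdCDF_comp μ (by fun_prop)), ← hmdef] at h
  simp only [integral_const, probReal_univ, one_smul, hst] at h
  linarith

lemma integral_stdCDF_le_of_le_sq (h3 : Integrable (fun x => |x| ^ 3) μ) {s t : ℝ} (hs : 0 < s)
    (ht : 0 < t) (hst : s ^ 2 + t ^ 2 = 1) (hm : ∫ x, x ∂μ = 0) (hv : ∫ x, x ^ 2 ∂μ = s ^ 2)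
    (hs2 : 0.9285 ≤ s ^ 2) (y : ℝ) :
    ∫ x, Φ ((y - x) / t) ∂μ ≤ Φ y + 0.56 * ∫ x, |x| ^ 3 ∂μ := by
  have hβ := cube_le_integral_abs_cube_s2 h3 hs hv
  have hpos := pow_four_le_mul_integral_pos h3 hs hm hv
  set β := ∫ x, |x| ^ 3 ∂μ with hβdef
  have hs1 : 0.9635 ≤ s := by nlinarith
  have hs3 : 0.8944 ≤ s ^ 3 := by
    calc (0.8944 : ℝ) ≤ 0.9635 ^ 3 := by norm_num
      _ ≤ s ^ 3 := by gcongr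
  have hlow : ∀ z : ℝ, z ≤ 0 → 1 / 2 + 2 / 5 * z ≤ Φ z := by
    intro z hz
    have := stdCDF_sub_le hz
    rw [stdCDF_zero] at this
    linarith
  rcases le_total 0 y with hy | hy
  · have h1 : ∫ x, Φ ((y - x) / t) ∂μ ≤ 1 := by
      have := integral_mono (integrable_stdCDF_comp μ (f := fun x => (y - x) / t) (by fun_prop))
        (integrable_const 1) (fun x => cdf_le_one _ _)
      simpa using this
    have h2 := monotone_cdf γ hy
    rw [stdCDF_zero] at h2
    linarith
  rcases le_total y (-1 / 2) with hy2 | hy2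
  · have h1 := integral_stdCDF_le_cantelli h3 ht hst hm hv (y := y) (by linarith)
    refine h1.trans ?_
    rw [div_le_iff₀ (by positivity)]
    rcases le_total y (-1) with hy3 | hy3
    · have := cdf_nonneg γ y
      nlinarith
    · have := hlow y hy
      have : 1 + 2 / 5 * y ≤ Φ y + 0.56 * β := by linarith
      have : 1 ≤ (1 + 2 / 5 * y) * (1 + y ^ 2) := by
        have : 0 ≤ -y * ((-y - 1 / 2) * (2 + y)) :=
          mul_nonneg (by linarith) (mul_nonneg (by linarith) (by linarith))
        nlinarith
      nlinarith [sq_nonneg y]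
  · have h1 : ∫ x, Φ ((y - x) / t) ∂μ ≤ ∫ x, Φ (-x / t) ∂μ := by
      refine integral_mono (integrable_stdCDF_comp μ (by fun_prop))
        (integrable_stdCDF_comp μ (by fun_prop)) fun x => monotone_cdf γ ?_
      gcongr
      linarith
    have h2 := sq_integral_pos_le h3 ht hst hv
    have h3' := hlow y hy
    set m := ∫ x in Set.Ioi 0, x ∂μ with hmdef
    have hm0 : 0 ≤ m := setIntegral_nonneg measurableSet_Ioi fun x hx => le_of_lt hx
    suffices 0.7 ≤ 0.56 * β + m ^ 2 by linarith
    have h4 : 0.862 ≤ s ^ 4 := by nlinarith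
    have h5 : 0.431 ≤ β * m := by linarith
    have h6 : 0.957 - 0.532 * β ≤ m := by
      have hβ0 : 0 < β := by linarith
      refine le_of_mul_le_mul_left (le_trans ?_ h5) hβ0
      nlinarith [sq_nonneg (β - 0.9)]
    nlinarith [sq_nonneg (m - 0.48)]

end LargeVariance

section MediumVariance

lemma mul_integral_sub_le {ν₁ ν₂ : Measure ℝ} [IsFiniteMeasure ν₁] [IsFiniteMeasure ν₂] {p : ℝ}
    (h₁ : ν₁.real Set.univ = p) (h₂ : ν₂.real Set.univ = p)
    (i1 : Integrable (fun x => x) ν₁) (i2 : Integrable (fun x => x ^ 2) ν₁)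
    (j1 : Integrable (fun x => x) ν₂) (j2 : Integrable (fun x => x ^ 2) ν₂)
    {g : ℝ → ℝ} {s K a : ℝ} (ha : 0 < a) (hK : 0 ≤ K) (hg : ∀ x x', g x - g x' ≤ K * |x - x'|)
    (ig : Integrable g ν₁) (jg : Integrable (fun n => g (s * n)) ν₂) :
    p * (∫ x, g x ∂ν₁ - ∫ n, g (s * n) ∂ν₂)
      ≤ K / (2 * a) * (p * ∫ x, x ^ 2 ∂ν₁ - 2 * s * (∫ x, x ∂ν₁) * (∫ n, n ∂ν₂)
          + s ^ 2 * p * ∫ n, n ^ 2 ∂ν₂) + K * a / 2 * p ^ 2 := by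
  have pointwise (x n : ℝ) : g x - g (s * n) ≤
      (K / (2 * a) * x ^ 2 + K * a / 2) + -(K / a * s * x) * n + K / (2 * a) * s ^ 2 * n ^ 2 := by
    have h : |x - s * n| ≤ (|x - s * n| ^ 2 + a ^ 2) / (2 * a) := by
      rw [le_div_iff₀ (by positivity)]
      nlinarith [sq_nonneg (|x - s * n| - a)]
    refine (hg x (s * n)).trans ((mul_le_mul_of_nonneg_left h hK).trans_eq ?_)
    rw [sq_abs]
    field_simp
    ring
  have inner (x : ℝ) : p * g x - ∫ n, g (s * n) ∂ν₂ ≤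
      (K / (2 * a) * s ^ 2 * (∫ n, n ^ 2 ∂ν₂) + K * a / 2 * p)
        + -(K / a * s * ∫ n, n ∂ν₂) * x + K / (2 * a) * p * x ^ 2 := by
    have h := integral_mono ((integrable_const (g x)).sub jg)
      (integrable_quadratic j1 j2 _ _ _) (pointwise x)
    simp only [Pi.sub_apply] at h
    rw [integral_sub (integrable_const _) jg, integral_quadratic j1 j2, integral_const, h₂,
      smul_eq_mul] at h
    linarith
  have h := integral_mono ((ig.const_mul p).sub (integrable_const (∫ n, g (s * n) ∂ν₂)))
    (integrable_quadratic i1 i2 _ _ _) inner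
  simp only [Pi.sub_apply] at h
  rw [integral_sub (ig.const_mul p) (integrable_const _), integral_quadratic i1 i2, integral_const,
    h₁, smul_eq_mul, integral_const_mul] at h
  refine (le_of_eq ?_).trans (h.trans_eq ?_)
  · ring
  · field_simp
    ring

lemma exists_stdCDF_eq {q : ℝ} (h0 : 0 < q) (h1 : q < 1) : ∃ z, Φ z = q :=
  mem_range_of_exists_le_of_exists_ge continuous_stdCDF
    (((tendsto_cdf_atBot γ).eventually (ge_mem_nhds h0)).exists)
    (((tendsto_cdf_atTop γ).eventually (le_mem_nhds h1)).exists)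

lemma stdCDF_add_linear_sub_le {t : ℝ} (ht : 0 < t) (y x x' : ℝ) :
    (Φ ((y - x) / t) + 0.2 / t * x) - (Φ ((y - x') / t) + 0.2 / t * x') ≤ 0.2 / t * |x - x'| := by
  rcases le_total x x' with h | h
  · have h1 : (y - x') / t ≤ (y - x) / t := by gcongr
    have h2 := stdCDF_sub_le h1
    rw [abs_of_nonpos (by linarith)]
    have h3 : 2 / 5 * ((y - x) / t - (y - x') / t) = 2 * (0.2 / t * (x' - x)) := by
      field_simp; ring
    linarith
  · have h1 : (y - x) / t ≤ (y - x') / t := by gcongr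
    have h2 := monotone_cdf γ h1
    rw [abs_of_nonneg (by linarith)]
    linarith

variable {μ : Measure ℝ} [IsProbabilityMeasure μ]

lemma integral_stdCDF_le_transport (h3 : Integrable (fun x => |x| ^ 3) μ) {s t a : ℝ} (hs : 0 < s)
    (ht : 0 < t) (ha : 0 < a) (hst : s ^ 2 + t ^ 2 = 1) (hm : ∫ x, x ∂μ = 0)
    (hv : ∫ x, x ^ 2 ∂μ = s ^ 2) (y : ℝ) :
    ∫ x, Φ ((y - x) / t) ∂μ ≤ Φ y
      + (0.2 / t / (2 * a) * (2 * s ^ 2 - 3.184 * s * ∫ x in Set.Ioi 0, x ∂μ)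
        + 0.2 / t * a / 2) := by
  have i1 := integrable_id_of_abs_cube h3
  have i2 := integrable_sq_of_abs_cube h3
  have j1 := integrable_id_stdGaussian
  have j2 := integrable_pow_stdGaussian 2
  have hm4 := pow_four_le_mul_integral_pos h3 hs hm hv
  have hβ : 0 ≤ ∫ x, |x| ^ 3 ∂μ := integral_nonneg fun x => by positivity
  have split {ν : Measure ℝ} {f : ℝ → ℝ} (hf : Integrable f ν) (z : ℝ) :
      ∫ x in Set.Ioi z, f x ∂ν + ∫ x in Set.Iic z, f x ∂ν = ∫ x, f x ∂ν := by
    rw [← Set.compl_Iic, add_comm]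
    exact integral_add_compl measurableSet_Iic hf
  have hneg := split i1 0
  set m := ∫ x in Set.Ioi 0, x ∂μ with hmdef
  have hm0 : 0 < m := by
    by_contra! h
    nlinarith [pow_pos hs 4, mul_nonneg hβ (neg_nonneg.2 h)]
  set p := μ.real (Set.Ioi 0) with hpdef
  have hq : μ.real (Set.Iic 0) = 1 - p := by
    rw [hpdef, ← Set.compl_Iic, probReal_compl_eq_one_sub measurableSet_Iic]
    ring
  have hp0 : 0 < p := by
    refine lt_of_le_of_ne measureReal_nonneg fun h => hm0.ne' ?_
    exact setIntegral_measure_zero _ ((measureReal_eq_zero_iff).1 h.symm)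
  have hp1 : 0 < 1 - p := by
    refine lt_of_le_of_ne (hq ▸ measureReal_nonneg) fun h => hm0.ne' ?_
    have := setIntegral_measure_zero (fun x : ℝ => x)
      ((measureReal_eq_zero_iff).1 (hq.trans h.symm))
    linarith
  obtain ⟨z, hz⟩ := exists_stdCDF_eq hp1 (by linarith : 1 - p < 1)
  have hz' : (γ).real (Set.Iic z) = 1 - p := by rw [← cdf_eq_real, hz]
  have hz'' : (γ).real (Set.Ioi z) = p := by
    rw [← Set.compl_Iic, probReal_compl_eq_one_sub measurableSet_Iic, hz']
    ring
  have hφ := stdCDF_mul_one_sub_le z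
  rw [hz] at hφ
  have ih : Integrable (fun x => Φ ((y - x) / t)) μ := integrable_stdCDF_comp μ (by fun_prop)
  have jh : Integrable (fun n => Φ ((y - s * n) / t)) γ := integrable_stdCDF_comp γ (by fun_prop)
  have ig : Integrable (fun x => Φ ((y - x) / t) + 0.2 / t * x) μ := ih.add (i1.const_mul _)
  have jg : Integrable (fun n => Φ ((y - s * n) / t) + 0.2 / t * (s * n)) γ :=
    jh.add ((j1.const_mul _).const_mul _)
  have hK : 0 ≤ 0.2 / t := by positivity
  have e1 := mul_integral_sub_le (ν₁ := μ.restrict (Set.Ioi 0)) (ν₂ := (γ).restrict (Set.Ioi z))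
    (p := p) (by simp [hpdef]) (by simpa using hz'') i1.restrict i2.restrict j1.restrict j2.restrict
    ha hK (stdCDF_add_linear_sub_le ht y) ig.restrict jg.restrict
  have e2 := mul_integral_sub_le (ν₁ := μ.restrict (Set.Iic 0)) (ν₂ := (γ).restrict (Set.Iic z))
    (p := 1 - p) (by simpa using hq) (by simpa using hz') i1.restrict i2.restrict j1.restrict
    j2.restrict ha hK (stdCDF_add_linear_sub_le ht y) ig.restrict jg.restrict
  have sg := split ig 0
  have sg' := split jg z
  have sv := split i2 0
  have sv' := split j2 z
  rw [integral_add ih (i1.const_mul _), integral_const_mul, hm] at sg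
  rw [integral_add jh ((j1.const_mul _).const_mul _), integral_const_mul, integral_const_mul,
    integral_id_gaussianReal, integral_stdCDF_stdGaussian ht hst] at sg'
  rw [hv] at sv
  rw [integral_sq_stdGaussian] at sv'
  rw [integral_Ioi_id_stdGaussian, ← hmdef] at e1
  rw [integral_Iic_id_stdGaussian, show ∫ x in Set.Iic 0, x ∂μ = -m by linarith] at e2
  generalize ∫ x in Set.Ioi 0, (Φ ((y - x) / t) + 0.2 / t * x) ∂μ = A₁ at *
  generalize ∫ x in Set.Iic 0, (Φ ((y - x) / t) + 0.2 / t * x) ∂μ = A₂ at *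
  generalize ∫ n in Set.Ioi z, (Φ ((y - s * n) / t) + 0.2 / t * (s * n)) ∂γ = B₁ at *
  generalize ∫ n in Set.Iic z, (Φ ((y - s * n) / t) + 0.2 / t * (s * n)) ∂γ = B₂ at *
  generalize ∫ x in Set.Ioi 0, x ^ 2 ∂μ = X₁ at *
  generalize ∫ n in Set.Ioi z, n ^ 2 ∂γ = N₁ at *
  obtain rfl : A₂ = ∫ x, Φ ((y - x) / t) ∂μ - A₁ := by linarith
  obtain rfl : B₂ = Φ y - B₁ := by linarith
  rw [show ∫ x in Set.Iic 0, x ^ 2 ∂μ = s ^ 2 - X₁ by linarith,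
    show ∫ n in Set.Iic z, n ^ 2 ∂γ = 1 - N₁ by linarith] at e2
  generalize ∫ x, Φ ((y - x) / t) ∂μ = A at *
  have hpq : 0 < p * (1 - p) := mul_pos hp0 hp1
  have key : p * (1 - p) * (A - Φ y) ≤ 0.2 / t / (2 * a) * (2 * s ^ 2 * (p * (1 - p))
      - 2 * s * m * φ z) + 0.2 / t * a / 2 * (p * (1 - p)) := by
    linear_combination (1 - p) * e1 + p * e2
  have hφ' : 2 * s * m * (1.592 * ((1 - p) * (1 - (1 - p)))) ≤ 2 * s * m * φ z := by gcongr
  have hC : 0 ≤ 0.2 / t / (2 * a) := by positivity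
  have key2 := mul_le_mul_of_nonneg_left hφ' hC
  refine sub_le_iff_le_add'.1 (le_of_mul_le_mul_left ?_ hpq)
  linarith

lemma integral_stdCDF_le_of_half_le_sq (h3 : Integrable (fun x => |x| ^ 3) μ) {s t : ℝ}
    (hs : 0 < s) (ht : 0 < t) (hst : s ^ 2 + t ^ 2 = 1) (hm : ∫ x, x ∂μ = 0)
    (hv : ∫ x, x ^ 2 ∂μ = s ^ 2) (hs1 : 1 / 2 ≤ s ^ 2) (hs2 : s ^ 2 ≤ 0.9285) (y : ℝ) :
    ∫ x, Φ ((y - x) / t) ∂μ ≤ Φ y + 0.56 * ∫ x, |x| ^ 3 ∂μ := by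
  have hβ := cube_le_integral_abs_cube_s2 h3 hs hv
  have hm4 := pow_four_le_mul_integral_pos h3 hs hm hv
  have main (a : ℝ) (ha : 0 < a) := integral_stdCDF_le_transport h3 hs ht ha hst hm hv y
  set β := ∫ x, |x| ^ 3 ∂μ with hβdef
  set m := ∫ x in Set.Ioi 0, x ∂μ with hmdef
  have hS : 0 < s ^ 3 := by positivity
  have hβ0 : 0 < β := hS.trans_le hβ
  set a := 0.69 * β / s ^ 2 with hadef
  have ha : 0 < a := by positivity
  have ha2 : 2 * s ^ 2 - 3.184 * s * m ≤ a ^ 2 := by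
    have h1 : s ^ 4 / (2 * β) ≤ m := by rwa [div_le_iff₀' (by positivity)]
    have h2 : 3.184 * s * (s ^ 4 / (2 * β)) ≤ 3.184 * s * m := by gcongr
    have h3 : 2 * s ^ 2 - 3.184 * s * (s ^ 4 / (2 * β)) ≤ a ^ 2 := by
      rw [hadef, ← sub_nonneg]
      have : (0.69 * β / s ^ 2) ^ 2 - (2 * s ^ 2 - 3.184 * s * (s ^ 4 / (2 * β)))
          = (0.4761 * β ^ 3 - 2 * (s ^ 3) ^ 2 * β + 1.592 * (s ^ 3) ^ 3) / (s ^ 4 * β) := by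
        field_simp
        ring
      rw [this]
      refine div_nonneg ?_ (by positivity)
      generalize s ^ 3 = S at *
      nlinarith [mul_nonneg (by positivity : 0 ≤ β + 2 * 1.184 * S) (sq_nonneg (β - 1.184 * S)),
        mul_pos (pow_pos hS 2) hβ0, pow_pos hS 3]
    linarith
  have h1 : 0.2 / t / (2 * a) * (2 * s ^ 2 - 3.184 * s * m) ≤ 0.2 / t / (2 * a) * a ^ 2 := by
    gcongr
  have h2 : 0.2 / t / (2 * a) * a ^ 2 = 0.2 / t * a / 2 := by
    field_simp
  have hst2 : 0.2465 ≤ s ^ 2 * t := by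
    refine le_of_sq_le_sq ?_ (by positivity)
    rw [mul_pow, show t ^ 2 = 1 - s ^ 2 by linarith]
    generalize s ^ 2 = v at *
    nlinarith [mul_nonneg (sub_nonneg.2 hs1) (sub_nonneg.2 hs2),
      mul_nonneg (mul_nonneg (sub_nonneg.2 hs1) (sub_nonneg.2 hs2)) (by linarith : 0 ≤ v)]
  have h4 : 0.2 / t * a ≤ 0.56 * β := by
    rw [hadef, show 0.2 / t * (0.69 * β / s ^ 2) = 0.138 * β / (s ^ 2 * t) by field_simp; norm_num,
      div_le_iff₀ (by positivity)]
    nlinarith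
  linarith [main a ha]

end MediumVariance

lemma integral_stdCDF_le {μ : Measure ℝ} [IsProbabilityMeasure μ]
    (h3 : Integrable (fun x => |x| ^ 3) μ) {s t : ℝ} (hs : 0 < s) (ht : 0 < t)
    (hst : s ^ 2 + t ^ 2 = 1) (hm : ∫ x, x ∂μ = 0) (hv : ∫ x, x ^ 2 ∂μ = s ^ 2) (y : ℝ) :
    ∫ x, Φ ((y - x) / t) ∂μ ≤ Φ y + 0.56 * ∫ x, |x| ^ 3 ∂μ := by
  rcases le_total (s ^ 2) (1 / 2) with h | h
  · exact integral_stdCDF_le_of_sq_le_half h3 hs ht hst hm hv h y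
  rcases le_total (s ^ 2) 0.9285 with h' | h'
  · exact integral_stdCDF_le_of_half_le_sq h3 hs ht hst hm hv h h' y
  · exact integral_stdCDF_le_of_le_sq h3 hs ht hst hm hv h' y

/-- Berry–Esseen bound for a centred law `μ` smoothed by a centred Gaussian, with unit total
variance. -/
lemma abs_cdf_conv_gaussianReal_sub_le {μ : Measure ℝ} [IsProbabilityMeasure μ]
    (h3 : Integrable (fun x => |x| ^ 3) μ) {s t : ℝ} (hs : 0 < s) (ht : 0 < t)
    (hst : s ^ 2 + t ^ 2 = 1) (hm : ∫ x, x ∂μ = 0) (hv : ∫ x, x ^ 2 ∂μ = s ^ 2)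
    {w : NNReal} (hw : (w : ℝ) = t ^ 2) (y : ℝ) :
    |cdf (μ.conv (gaussianReal 0 w)) y - Φ y| ≤ 0.56 * ∫ x, |x| ^ 3 ∂μ := by
  rw [cdf_conv_gaussianReal μ ht hw]
  have upper := integral_stdCDF_le h3 hs ht hst hm hv y
  have hneg : Measurable fun x : ℝ => -x := measurable_neg
  have : IsProbabilityMeasure (μ.map fun x => -x) :=
    Measure.isProbabilityMeasure_map hneg.aemeasurable
  have h3' : Integrable (fun x => |x| ^ 3) (μ.map fun x => -x) := by
    rw [integrable_map_measure (by fun_prop) hneg.aemeasurable]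
    simpa [Function.comp_def] using h3
  have map {f : ℝ → ℝ} (hf : Measurable f) : ∫ x, f x ∂(μ.map fun x => -x) = ∫ x, f (-x) ∂μ :=
    integral_map hneg.aemeasurable hf.aestronglyMeasurable
  have lower := integral_stdCDF_le h3' hs ht hst
    (by rw [map measurable_id', integral_neg, hm, neg_zero])
    (by rw [map (by fun_prop)]; simpa using hv) (-y)
  rw [map (f := fun x => Φ ((-y - x) / t)) (continuous_stdCDF.measurable.comp (by fun_prop)),
    map (by fun_prop)] at lower
  have hrefl (x : ℝ) : Φ ((-y - -x) / t) = 1 - Φ ((y - x) / t) := by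
    rw [← stdCDF_neg]
    congr 1
    ring
  simp only [hrefl, abs_neg, stdCDF_neg] at lower
  rw [integral_sub (integrable_const _) (integrable_stdCDF_comp μ (by fun_prop))] at lower
  simp only [integral_const, probReal_univ, one_smul] at lower
  rw [abs_le]
  constructor <;> linarith

/-- Intermediate Berry–Esseen bound for the decomposed Gaussian: with `L̃` centered, of
variance `σ_L² > 0` and finite third absolute moment, and `G̃ ∼ N(0, σ_G²)` independent of
`L̃`, the CDF of `Y = (L̃ + G̃)/√(σ_L² + σ_G²)` is, for every integer `M ≥ 2`, uniformly
within `0.56 · (E|L̃|³ + (2√2/√π)·σ_G³/√(M−1)) / (√(σ_L² + σ_G²))³` of the standard normal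
CDF, where `σ_G³ = (σ_G²)^{3/2}`. -/
theorem berry_esseen_decomposed_gaussian
    {Ω : Type*} [MeasureSpace Ω] [IsProbabilityMeasure (ℙ : Measure Ω)]
    (Lt Gt : Ω → ℝ) (σL2 σG2 : ℝ) (hσL : 0 < σL2) (hσG : 0 < σG2)
    (hLmeas : Measurable Lt)
    (hLmean : ∫ ω, Lt ω = 0)
    (hLvar : ∫ ω, (Lt ω) ^ 2 = σL2)
    (hL3 : Integrable (fun ω => |Lt ω| ^ 3) ℙ)
    (hG : Measure.map Gt ℙ = gaussianReal 0 ⟨σG2, hσG.le⟩)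
    (hindep : IndepFun Lt Gt ℙ)
    (M : ℕ) (hM : 2 ≤ M)
    (y : ℝ) :
    |cdf (Measure.map (fun ω => (Lt ω + Gt ω) / Real.sqrt (σL2 + σG2)) ℙ) y
        - cdf (gaussianReal 0 1) y|
      ≤ 0.56 * ((∫ ω, |Lt ω| ^ 3)
            + (2 * Real.sqrt 2 / Real.sqrt π) * σG2 ^ ((3 : ℝ) / 2)
              / Real.sqrt ((M : ℝ) - 1))
          / (Real.sqrt (σL2 + σG2)) ^ 3 := by
  set σ := √(σL2 + σG2) with hσdef
  have hσ2 : σ ^ 2 = σL2 + σG2 := sq_sqrt (by positivity)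
  have hσ : 0 < σ := sqrt_pos.2 (by positivity)
  obtain ⟨v, hv, hGv⟩ : ∃ v : NNReal, (v : ℝ) = σG2 ∧ Measure.map Gt ℙ = gaussianReal 0 v :=
    ⟨_, rfl, hG⟩
  have hGmeas : AEMeasurable Gt ℙ :=
    AEMeasurable.of_map_ne_zero (by rw [hGv]; exact IsProbabilityMeasure.ne_zero _)
  have hX : Measurable fun ω => Lt ω / σ := hLmeas.div_const σ
  set μ := Measure.map (fun ω => Lt ω / σ) (ℙ : Measure Ω) with hμ
  have : IsProbabilityMeasure μ := Measure.isProbabilityMeasure_map hX.aemeasurable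
  obtain ⟨w, hw, hGlaw⟩ : ∃ w : NNReal, (w : ℝ) = σG2 / σ ^ 2 ∧
      Measure.map (fun ω => Gt ω / σ) (ℙ : Measure Ω) = gaussianReal 0 w := by
    have h := gaussianReal_map_div_const (μ := 0) (v := v) σ
    rw [← hGv, AEMeasurable.map_map_of_aemeasurable (by fun_prop) hGmeas, zero_div] at h
    exact ⟨_, by simp [hv], h⟩
  have hind : IndepFun (fun ω => Lt ω / σ) (fun ω => Gt ω / σ) ℙ :=
    hindep.comp (measurable_id.div_const σ) (measurable_id.div_const σ)
  have hlaw : Measure.map (fun ω => (Lt ω + Gt ω) / σ) (ℙ : Measure Ω)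
      = μ.conv (gaussianReal 0 w) := by
    rw [hμ, ← hGlaw, ← hind.map_add_eq_map_conv_map₀ hX.aemeasurable (hGmeas.div_const σ)]
    simp only [add_div]
    rfl
  have map {f : ℝ → ℝ} (hf : Measurable f) : ∫ x, f x ∂μ = ∫ ω, f (Lt ω / σ) :=
    integral_map hX.aemeasurable hf.aestronglyMeasurable
  have habs (ω : Ω) : |Lt ω / σ| ^ 3 = |Lt ω| ^ 3 / σ ^ 3 := by
    rw [abs_div, abs_of_pos hσ, div_pow]
  have h3 : Integrable (fun x => |x| ^ 3) μ := by
    rw [hμ, integrable_map_measure (by fun_prop) hX.aemeasurable]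
    simpa only [Function.comp_def, habs] using hL3.div_const (σ ^ 3)
  have hs2 : (√σL2 / σ) ^ 2 = σL2 / σ ^ 2 := by rw [div_pow, sq_sqrt hσL.le]
  have ht2 : (√σG2 / σ) ^ 2 = σG2 / σ ^ 2 := by rw [div_pow, sq_sqrt hσG.le]
  have hst : (√σL2 / σ) ^ 2 + (√σG2 / σ) ^ 2 = 1 := by
    rw [hs2, ht2, ← add_div, ← hσ2, div_self (by positivity)]
  have bound := abs_cdf_conv_gaussianReal_sub_le h3 (div_pos (sqrt_pos.2 hσL) hσ)
    (div_pos (sqrt_pos.2 hσG) hσ) hst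
    (by rw [map measurable_id', integral_div, hLmean, zero_div])
    (by rw [map (by fun_prop), hs2]; simp only [div_pow]; rw [integral_div, hLvar])
    (hw.trans ht2.symm) y
  rw [map (by fun_prop)] at bound
  simp only [habs] at bound
  rw [integral_div, ← mul_div_assoc] at bound
  rw [hlaw]
  refine bound.trans ?_
  gcongr
  exact le_add_of_nonneg_right (by positivity)
end
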